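/- Let 3 ≤ n ≤ 6 and let u ∈ C²(B₁) with 0 ≤ u < 1 be a stable solution of −Δu = f(u) in the unit ball B₁ ⊂ ℝⁿ, where f ∈ C²([0,1)) satisfies f ≥ 0 and there exist θ > 0, K ≥ 0 with f″(t)f(t) ≥ (1+θ)f′(t)² − K for all 0 ≤ t < 1. Then there exists a constant C, depending only on n, θ, and K, such that ∫_{B_{3/16}} ( f(u(x))² + |x|² |∇(f∘u)(x)|² ) |x|^{2−n} dx ≤ C (∫_{B_{3/4}} u dx)². -/

import Mathlib

open MeasureTheory Set Filter Topology Bornology Metric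

/-- The Laplacian of `u : ℝⁿ → ℝ`, as the sum of second partial derivatives. -/
noncomputable def lap {n : ℕ} (u : EuclideanSpace ℝ (Fin n) → ℝ)
    (x : EuclideanSpace ℝ (Fin n)) : ℝ :=
  ∑ i, fderiv ℝ (fun y => fderiv ℝ u y (EuclideanSpace.single i 1)) x (EuclideanSpace.single i 1)

/-- `f` is of class `C²([0,1))`, with first and second derivatives `f'`, `f''`. -/
def C2On01 (f f' f'' : ℝ → ℝ) : Prop :=
  (∀ t ∈ Ico (0:ℝ) 1, HasDerivWithinAt f (f' t) (Ico (0:ℝ) 1) t) ∧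
  (∀ t ∈ Ico (0:ℝ) 1, HasDerivWithinAt f' (f'' t) (Ico (0:ℝ) 1) t) ∧
  ContinuousOn f'' (Ico (0:ℝ) 1)

/-- Stability of a solution `u` of `-Δu = f(u)` in `Ω`: nonnegativity of the second variation of
the energy on all smooth test functions compactly supported in `Ω`. Here `f'` is the derivative
of the nonlinearity. -/
def StableSol {n : ℕ} (f' : ℝ → ℝ) (u : EuclideanSpace ℝ (Fin n) → ℝ)
    (Ω : Set (EuclideanSpace ℝ (Fin n))) : Prop :=
  ∀ ξ : EuclideanSpace ℝ (Fin n) → ℝ, ContDiff ℝ (⊤:ℕ∞) ξ → HasCompactSupport ξ →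
    tsupport ξ ⊆ Ω →
    0 ≤ ∫ x in Ω, (‖gradient ξ x‖ ^ 2 - f' (u x) * ξ x ^ 2)

section Gradient

variable {E : Type*} [NormedAddCommGroup E] [InnerProductSpace ℝ E] [CompleteSpace E]

theorem norm_gradient (f : E → ℝ) (x : E) : ‖gradient f x‖ = ‖fderiv ℝ f x‖ := by
  simp [gradient]

theorem gradient_fun_mul {f g : E → ℝ} {x : E} (hf : DifferentiableAt ℝ f x)
    (hg : DifferentiableAt ℝ g x) :
    gradient (fun y => f y * g y) x = f x • gradient g x + g x • gradient f x := by
  simp [gradient, fderiv_fun_mul hf hg]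

theorem gradient_fun_pow {f : E → ℝ} {x : E} (hf : DifferentiableAt ℝ f x) (k : ℕ) :
    gradient (fun y => f y ^ k) x = (k * f x ^ (k - 1)) • gradient f x := by
  simp [gradient, fderiv_fun_pow k hf]

theorem gradient_fun_add {f g : E → ℝ} {x : E} (hf : DifferentiableAt ℝ f x)
    (hg : DifferentiableAt ℝ g x) :
    gradient (fun y => f y + g y) x = gradient f x + gradient g x := by
  simp [gradient, fderiv_fun_add hf hg]

theorem contDiff_gradient {f : E → ℝ} {k : WithTop ℕ∞} (hf : ContDiff ℝ (k + 1) f) :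
    ContDiff ℝ k (gradient f) :=
  (InnerProductSpace.toDual ℝ E).symm.contDiff.comp (hf.fderiv_right le_rfl)

theorem continuous_gradient {f : E → ℝ} (hf : ContDiff ℝ 1 f) : Continuous (gradient f) :=
  (contDiff_gradient (k := 0) (by simpa using hf)).continuous

theorem gradient_eq_zero_of_notMem_tsupport {f : E → ℝ} {x : E} (hx : x ∉ tsupport f) :
    gradient f x = 0 := by
  have : fderiv ℝ f x = 0 := by
    by_contra h
    exact hx (support_fderiv_subset ℝ h)
  simp [gradient, this]

theorem hasCompactSupport_gradient {f : E → ℝ} (hf : HasCompactSupport f) :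
    HasCompactSupport (gradient f) :=
  hf.mono' fun x hx => by
    by_contra h
    exact hx (gradient_eq_zero_of_notMem_tsupport h)

end Gradient

section Divergence

variable {n : ℕ}

/-- The divergence of a vector field on `ℝⁿ`. -/
noncomputable def divg (X : EuclideanSpace ℝ (Fin n) → EuclideanSpace ℝ (Fin n))
    (x : EuclideanSpace ℝ (Fin n)) : ℝ :=
  ∑ i, fderiv ℝ (fun y => X y i) x (EuclideanSpace.single i 1)

theorem fderiv_single_eq_gradient (u : EuclideanSpace ℝ (Fin n) → ℝ)
    (x : EuclideanSpace ℝ (Fin n)) (i : Fin n) :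
    fderiv ℝ u x (EuclideanSpace.single i 1) = gradient u x i := by
  rw [← inner_gradient_left, EuclideanSpace.inner_single_right]
  simp

theorem lap_eq_divg_gradient (u : EuclideanSpace ℝ (Fin n) → ℝ)
    (x : EuclideanSpace ℝ (Fin n)) : lap u x = divg (gradient u) x := by
  simp only [lap, divg, fderiv_single_eq_gradient]

theorem contDiff_coord {k : WithTop ℕ∞}
    {X : EuclideanSpace ℝ (Fin n) → EuclideanSpace ℝ (Fin n)} (hX : ContDiff ℝ k X) (i : Fin n) :
    ContDiff ℝ k (fun y => X y i) := contDiff_euclidean.1 hX i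

theorem integral_mul_divg {g : EuclideanSpace ℝ (Fin n) → ℝ}
    {X : EuclideanSpace ℝ (Fin n) → EuclideanSpace ℝ (Fin n)}
    (hg : ContDiff ℝ 1 g) (hgc : HasCompactSupport g) (hX : ContDiff ℝ 1 X) :
    ∫ x, g x * divg X x = -∫ x, inner ℝ (gradient g x) (X x) := by
  have hXi := fun i => contDiff_coord hX i
  have c1 : ∀ i, Continuous fun x => fderiv ℝ g x (EuclideanSpace.single i 1) := fun i =>
    (hg.continuous_fderiv one_ne_zero).clm_apply continuous_const
  have c2 : ∀ i, Continuous fun x => fderiv ℝ (fun y => X y i) x (EuclideanSpace.single i 1) :=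
    fun i => ((hXi i).continuous_fderiv one_ne_zero).clm_apply continuous_const
  have s1 : ∀ i, HasCompactSupport fun x => fderiv ℝ g x (EuclideanSpace.single i 1) := fun i =>
    hgc.fderiv_apply ℝ _
  have i1 : ∀ i, Integrable fun x => fderiv ℝ g x (EuclideanSpace.single i 1) * X x i := fun i =>
    ((c1 i).mul (hXi i).continuous).integrable_of_hasCompactSupport (s1 i).mul_right
  have i2 : ∀ i, Integrable fun x =>
      g x * fderiv ℝ (fun y => X y i) x (EuclideanSpace.single i 1) := fun i =>
    (hg.continuous.mul (c2 i)).integrable_of_hasCompactSupport hgc.mul_right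
  have i3 : ∀ i, Integrable fun x => g x * X x i := fun i =>
    (hg.continuous.mul (hXi i).continuous).integrable_of_hasCompactSupport hgc.mul_right
  have e1 : ∀ x, inner ℝ (gradient g x) (X x) =
      ∑ i, fderiv ℝ g x (EuclideanSpace.single i 1) * X x i := fun x => by
    simp only [fderiv_single_eq_gradient, PiLp.inner_apply]
    exact Finset.sum_congr rfl fun i _ => by simp [mul_comm]
  simp only [divg, Finset.mul_sum, e1]
  rw [integral_finsetSum _ fun i _ => i2 i, integral_finsetSum _ fun i _ => i1 i,
    ← Finset.sum_neg_distrib]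
  exact Finset.sum_congr rfl fun i _ =>
    integral_mul_fderiv_eq_neg_fderiv_mul_of_integrable (i1 i) (i2 i) (i3 i)
      (fun x _ => hg.differentiable one_ne_zero x)
      (fun x _ => (hXi i).differentiable one_ne_zero x)

theorem integral_mul_lap {g u : EuclideanSpace ℝ (Fin n) → ℝ}
    (hg : ContDiff ℝ 1 g) (hgc : HasCompactSupport g) (hu : ContDiff ℝ 2 u) :
    ∫ x, g x * lap u x = -∫ x, inner ℝ (gradient g x) (gradient u x) := by
  simp only [lap_eq_divg_gradient]
  exact integral_mul_divg hg hgc (contDiff_gradient (by simpa [one_add_one_eq_two] using hu))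

theorem continuous_divg {X : EuclideanSpace ℝ (Fin n) → EuclideanSpace ℝ (Fin n)}
    (hX : ContDiff ℝ 1 X) : Continuous (divg X) :=
  continuous_finsetSum _ fun i _ =>
    ((contDiff_coord hX i).continuous_fderiv one_ne_zero).clm_apply continuous_const

theorem continuous_lap {u : EuclideanSpace ℝ (Fin n) → ℝ} (hu : ContDiff ℝ 2 u) :
    Continuous (lap u) := by
  rw [funext (lap_eq_divg_gradient u)]
  exact continuous_divg (contDiff_gradient (by simpa [one_add_one_eq_two] using hu))

theorem lap_eq_zero_of_notMem_tsupport {u : EuclideanSpace ℝ (Fin n) → ℝ}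
    {x : EuclideanSpace ℝ (Fin n)} (hx : x ∉ tsupport u) : lap u x = 0 := by
  refine Finset.sum_eq_zero fun i _ => ?_
  have h : (fun y => fderiv ℝ u y (EuclideanSpace.single i 1)) =ᶠ[𝓝 x] fun _ => 0 := by
    filter_upwards [(isClosed_tsupport u).isOpen_compl.mem_nhds hx] with y hy
    have : fderiv ℝ u y = 0 := by
      by_contra h
      exact hy (support_fderiv_subset ℝ h)
    simp [this]
  simp [h.fderiv_eq]

end Divergence

section Mollification

open scoped Convolution

variable {E : Type*} [NormedAddCommGroup E] [InnerProductSpace ℝ E] [FiniteDimensional ℝ E]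
  [MeasurableSpace E] [BorelSpace E]

theorem exists_contDiff_norm_fderiv_sub_le {ξ : E → ℝ} (hξ : ContDiff ℝ 1 ξ)
    (hc : HasCompactSupport ξ) {U : Set E} (hU : IsOpen U) (hs : tsupport ξ ⊆ U) {δ : ℝ}
    (hδ : 0 < δ) :
    ∃ ζ : E → ℝ, ContDiff ℝ (⊤ : ℕ∞) ζ ∧ HasCompactSupport ζ ∧ tsupport ζ ⊆ U ∧
      ∀ x, ‖ζ x - ξ x‖ ≤ δ ∧ ‖fderiv ℝ ζ x - fderiv ℝ ξ x‖ ≤ δ := by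
  obtain ⟨ε, hε, hεU⟩ := hc.isCompact.exists_cthickening_subset_open hU hs
  have hcξ := hξ.continuous
  have hcD := hξ.continuous_fderiv one_ne_zero
  have hcs : HasCompactSupport (fderiv ℝ ξ) := hc.fderiv ℝ
  obtain ⟨r1, hr1, h1⟩ := Metric.uniformContinuous_iff.1
    (hc.uniformContinuous_of_continuous hcξ) δ hδ
  obtain ⟨r2, hr2, h2⟩ := Metric.uniformContinuous_iff.1
    (hcs.uniformContinuous_of_continuous hcD) δ hδ
  set r := min ε (min r1 r2) with hr
  have hrpos : 0 < r := lt_min hε (lt_min hr1 hr2)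
  let φ : ContDiffBump (0 : E) := ⟨r / 2, r, by linarith, by linarith⟩
  have hts : tsupport (φ.normed volume ⋆[ContinuousLinearMap.lsmul ℝ ℝ, volume] ξ) ⊆
      cthickening ε (tsupport ξ) := by
    refine closure_minimal ?_ isClosed_cthickening
    refine (support_convolution_subset _).trans ?_
    rintro _ ⟨a, ha, b, hb, rfl⟩
    rw [φ.support_normed_eq, mem_ball_zero_iff] at ha
    refine mem_cthickening_of_dist_le _ b _ _ (subset_tsupport _ hb) ?_
    simp only [dist_eq_norm, add_sub_cancel_right]
    exact ha.le.trans (min_le_left _ _)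
  refine ⟨φ.normed volume ⋆[ContinuousLinearMap.lsmul ℝ ℝ, volume] ξ, ?_, ?_, hts.trans hεU, ?_⟩
  · exact φ.hasCompactSupport_normed.contDiff_convolution_left _ φ.contDiff_normed
      (hcξ.locallyIntegrable)
  · exact HasCompactSupport.of_support_subset_isCompact hc.isCompact.cthickening
      ((subset_tsupport _).trans hts)
  · intro x
    constructor
    · rw [← dist_eq_norm]
      refine φ.dist_normed_convolution_le hcξ.aestronglyMeasurable fun y hy => ?_
      exact (h1 (lt_of_lt_of_le hy ((min_le_right _ _).trans (min_le_left _ _)))).le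
    · rw [(hc.hasFDerivAt_convolution_right (ContinuousLinearMap.lsmul ℝ ℝ)
        φ.continuous_normed.locallyIntegrable hξ x).fderiv, ← dist_eq_norm]
      have : (ContinuousLinearMap.lsmul ℝ ℝ : ℝ →L[ℝ] ℝ →L[ℝ] ℝ).precompR E =
          ContinuousLinearMap.lsmul ℝ ℝ := by
        ext c L
        simp [ContinuousLinearMap.precompR]
      rw [this]
      refine φ.dist_normed_convolution_le hcD.aestronglyMeasurable fun y hy => ?_
      exact (h2 (lt_of_lt_of_le hy ((min_le_right _ _).trans (min_le_right _ _)))).le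

/-- A stability inequality for smooth test functions extends to `C¹` test functions. -/
theorem stability_of_contDiff_one {c : E → ℝ} (hcc : Continuous c) (hcs : HasCompactSupport c)
    {r : ℝ}
    (h : ∀ ξ : E → ℝ, ContDiff ℝ (⊤ : ℕ∞) ξ → HasCompactSupport ξ → tsupport ξ ⊆ ball 0 r →
      0 ≤ ∫ x in ball (0 : E) r, (‖gradient ξ x‖ ^ 2 - c x * ξ x ^ 2))
    {ξ : E → ℝ} (hξ : ContDiff ℝ 1 ξ) (hξc : HasCompactSupport ξ) (hs : tsupport ξ ⊆ ball 0 r) :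
    0 ≤ ∫ x in ball (0 : E) r, (‖gradient ξ x‖ ^ 2 - c x * ξ x ^ 2) := by
  have hpos : ∀ k : ℕ, (0 : ℝ) < 1 / ((k : ℝ) + 1) := fun k => by positivity
  choose ζ h1 h2 h3 h4 using fun k : ℕ =>
    exists_contDiff_norm_fderiv_sub_le hξ hξc isOpen_ball hs (hpos k)
  obtain ⟨A, hA⟩ := hcs.exists_bound_of_continuous hcc
  obtain ⟨B, hB⟩ := hξc.exists_bound_of_continuous hξ.continuous
  obtain ⟨D, hD⟩ := (hξc.fderiv ℝ).exists_bound_of_continuous (hξ.continuous_fderiv one_ne_zero)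
  have h0 : Tendsto (fun k : ℕ => 1 / ((k : ℝ) + 1)) atTop (𝓝 0) :=
    tendsto_one_div_add_atTop_nhds_zero_nat
  have hle1 : ∀ k : ℕ, 1 / ((k : ℝ) + 1) ≤ 1 := fun k => by
    rw [div_le_one (by positivity)]
    linarith [(k.cast_nonneg : (0 : ℝ) ≤ k)]
  refine ge_of_tendsto' (x := atTop) (f := fun k =>
    ∫ x in ball (0 : E) r, (‖gradient (ζ k) x‖ ^ 2 - c x * ζ k x ^ 2)) ?_
    fun k => h _ (h1 k) (h2 k) (h3 k)
  simp only [norm_gradient]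
  refine tendsto_integral_of_dominated_convergence (fun _ => (D + 1) ^ 2 + A * (B + 1) ^ 2)
    (fun k => ?_) ?_ (fun k => ?_) ?_
  · have : ContDiff ℝ 1 (ζ k) := (h1 k).of_le (by exact_mod_cast le_top)
    have := this.continuous_fderiv one_ne_zero
    have := (h1 k).continuous
    exact Continuous.aestronglyMeasurable (by fun_prop)
  · exact integrable_const_iff.2 (Or.inr ⟨by simpa using measure_ball_lt_top⟩)
  · refine Eventually.of_forall fun x => ?_
    have a1 : ‖fderiv ℝ (ζ k) x‖ ≤ D + 1 := by
      have := norm_le_norm_add_norm_sub' (fderiv ℝ (ζ k) x) (fderiv ℝ ξ x)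
      linarith [hD x, (h4 k x).2, hle1 k]
    have a2 : ‖ζ k x‖ ≤ B + 1 := by
      have := norm_le_norm_add_norm_sub' (ζ k x) (ξ x)
      linarith [hB x, (h4 k x).1, hle1 k]
    have hA0 : 0 ≤ A := (norm_nonneg _).trans (hA x)
    calc ‖‖fderiv ℝ (ζ k) x‖ ^ 2 - c x * ζ k x ^ 2‖
        ≤ ‖‖fderiv ℝ (ζ k) x‖ ^ 2‖ + ‖c x * ζ k x ^ 2‖ := norm_sub_le _ _
      _ = ‖fderiv ℝ (ζ k) x‖ ^ 2 + ‖c x‖ * ‖ζ k x‖ ^ 2 := by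
          rw [norm_mul, norm_pow, norm_pow, norm_norm]
      _ ≤ _ := by
          gcongr
          exact hA x
  · refine Eventually.of_forall fun x => ?_
    have t1 : Tendsto (fun k => fderiv ℝ (ζ k) x) atTop (𝓝 (fderiv ℝ ξ x)) :=
      tendsto_iff_norm_sub_tendsto_zero.2
        (squeeze_zero (fun _ => norm_nonneg _) (fun k => (h4 k x).2) h0)
    have t2 : Tendsto (fun k => ζ k x) atTop (𝓝 (ξ x)) :=
      tendsto_iff_norm_sub_tendsto_zero.2
        (squeeze_zero (fun _ => norm_nonneg _) (fun k => (h4 k x).1) h0)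
    exact (t1.norm.pow 2).sub (tendsto_const_nhds.mul (t2.pow 2))

end Mollification

section StablePair

variable {n : ℕ}

/-- A pair of globally defined `C²` functions which behaves, in the ball of radius `3/4`, like a
stable solution `u` together with `w = f ∘ u = -Δu`: the Caccioppoli-type inequality `stab` is what
remains of stability after testing it with `w η`. -/
structure StablePair (θ K : ℝ) (u w : EuclideanSpace ℝ (Fin n) → ℝ) : Prop where
  contDiff_left : ContDiff ℝ 2 u
  contDiff_right : ContDiff ℝ 2 w
  hasCompactSupport_left : HasCompactSupport u
  nonneg_left : ∀ x ∈ ball 0 (3 / 4), 0 ≤ u x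
  nonneg_right : ∀ x ∈ ball 0 (3 / 4), 0 ≤ w x
  lap_eq : ∀ x ∈ ball 0 (3 / 4), lap u x = -w x
  stab : ∀ η : EuclideanSpace ℝ (Fin n) → ℝ, ContDiff ℝ 1 η → HasCompactSupport η →
    tsupport η ⊆ ball 0 (3 / 4) →
    (1 + θ) * ∫ x, ‖gradient w x‖ ^ 2 * η x ^ 2 ≤
      (∫ x, w x ^ 2 * ‖gradient η x‖ ^ 2) + K * ∫ x, ‖gradient u x‖ ^ 2 * η x ^ 2

theorem norm_gradient_mul_sq {w η : EuclideanSpace ℝ (Fin n) → ℝ}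
    (hw : Differentiable ℝ w) (hη : Differentiable ℝ η) (x : EuclideanSpace ℝ (Fin n)) :
    ‖gradient (fun y => w y * η y) x‖ ^ 2 = w x ^ 2 * ‖gradient η x‖ ^ 2 +
      inner ℝ (gradient (fun y => w y * η y ^ 2) x) (gradient w x) := by
  have hη2 : DifferentiableAt ℝ (fun y => η y ^ 2) x := (hη x).pow 2
  rw [gradient_fun_mul (hw x) (hη x), gradient_fun_mul (hw x) hη2, gradient_fun_pow (hη x)]
  simp only [norm_add_sq_real, inner_add_left, real_inner_smul_left, real_inner_smul_right,
    norm_smul, mul_pow, Real.norm_eq_abs, sq_abs, real_inner_self_eq_norm_sq, smul_smul]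
  push_cast
  ring

theorem stab_of_lap_ge {θ K r : ℝ} {u w c : EuclideanSpace ℝ (Fin n) → ℝ} (hu : ContDiff ℝ 1 u)
    (hw : ContDiff ℝ 2 w) (hc : Continuous c)
    (hlap : ∀ x ∈ ball 0 r, (1 + θ) * ‖gradient w x‖ ^ 2 - K * ‖gradient u x‖ ^ 2 ≤
      w x * lap w x + c x * w x ^ 2)
    (hst : ∀ ξ : EuclideanSpace ℝ (Fin n) → ℝ, ContDiff ℝ 1 ξ → HasCompactSupport ξ →
      tsupport ξ ⊆ ball 0 r → 0 ≤ ∫ x in ball 0 r, (‖gradient ξ x‖ ^ 2 - c x * ξ x ^ 2))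
    {η : EuclideanSpace ℝ (Fin n) → ℝ} (hη : ContDiff ℝ 1 η) (hηc : HasCompactSupport η)
    (hηs : tsupport η ⊆ ball 0 r) :
    (1 + θ) * ∫ x, ‖gradient w x‖ ^ 2 * η x ^ 2 ≤
      (∫ x, w x ^ 2 * ‖gradient η x‖ ^ 2) + K * ∫ x, ‖gradient u x‖ ^ 2 * η x ^ 2 := by
  have hw1 : ContDiff ℝ 1 w := hw.of_le one_le_two
  have cw := hw.continuous
  have cη := hη.continuous
  have cgw := continuous_gradient hw1
  have cgu := continuous_gradient hu
  have cgη := continuous_gradient hη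
  have clw := continuous_lap hw
  have hη2c : HasCompactSupport fun x => η x ^ 2 := by
    simp only [sq]
    exact hηc.mul_right
  have hgη2c : HasCompactSupport fun x => ‖gradient η x‖ ^ 2 := by
    simp only [sq]
    exact (hasCompactSupport_gradient hηc).norm.mul_right
  have hg : ContDiff ℝ 1 fun x => w x * η x ^ 2 := hw1.mul (hη.pow 2)
  have hgc : HasCompactSupport fun x => w x * η x ^ 2 := hη2c.mul_left
  have hts : tsupport (fun x => w x * η x) ⊆ ball 0 r :=
    (tsupport_mul_subset_right).trans hηs
  have h0 := hst (fun x => w x * η x) (hw1.mul hη) hηc.mul_left hts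
  rw [setIntegral_eq_integral_of_forall_compl_eq_zero] at h0
  swap
  · intro x hx
    have hx' : x ∉ tsupport (fun x => w x * η x) := fun h => hx (hts h)
    have : η x = 0 := image_eq_zero_of_notMem_tsupport fun h => hx (hηs h)
    simp [gradient_eq_zero_of_notMem_tsupport hx', this]
  have hibp := integral_mul_lap hg hgc hw
  have i1 : Integrable fun x => w x ^ 2 * ‖gradient η x‖ ^ 2 :=
    Continuous.integrable_of_hasCompactSupport (by fun_prop) hgη2c.mul_left
  have i2 : Integrable fun x =>
      inner ℝ (gradient (fun y => w y * η y ^ 2) x) (gradient w x) := by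
    refine Continuous.integrable_of_hasCompactSupport ((continuous_gradient hg).inner cgw) ?_
    exact (hasCompactSupport_gradient hgc).mono fun x hx h => hx (by simp [h])
  have i3 : Integrable fun x => c x * (w x * η x) ^ 2 := by
    refine Continuous.integrable_of_hasCompactSupport (by fun_prop) ?_
    simp only [mul_pow]
    exact hη2c.mul_left.mul_left
  have i4 : Integrable fun x => w x * η x ^ 2 * lap w x :=
    Continuous.integrable_of_hasCompactSupport (by fun_prop) hgc.mul_right
  have i5 : Integrable fun x => ‖gradient w x‖ ^ 2 * η x ^ 2 :=
    Continuous.integrable_of_hasCompactSupport (by fun_prop) hη2c.mul_left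
  have i6 : Integrable fun x => ‖gradient u x‖ ^ 2 * η x ^ 2 :=
    Continuous.integrable_of_hasCompactSupport (by fun_prop) hη2c.mul_left
  simp only [norm_gradient_mul_sq (hw1.differentiable one_ne_zero)
    (hη.differentiable one_ne_zero)] at h0
  rw [integral_sub (i1.fun_add i2) i3, integral_add i1 i2] at h0
  have key : (∫ x, ((1 + θ) * (‖gradient w x‖ ^ 2 * η x ^ 2) -
      K * (‖gradient u x‖ ^ 2 * η x ^ 2))) ≤
      ∫ x, (w x * η x ^ 2 * lap w x + c x * (w x * η x) ^ 2) := by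
    refine integral_mono ((i5.const_mul _).sub (i6.const_mul _)) (i4.add i3) fun x => ?_
    by_cases hx : x ∈ ball 0 r
    · have := mul_le_mul_of_nonneg_right (hlap x hx) (sq_nonneg (η x))
      simp only
      nlinarith [this]
    · have : η x = 0 := image_eq_zero_of_notMem_tsupport fun h => hx (hηs h)
      simp [this]
  rw [integral_sub (i5.const_mul _) (i6.const_mul _), integral_add i4 i3, integral_const_mul,
    integral_const_mul] at key
  linarith

end StablePair

section Reduction

variable {n : ℕ}

theorem contDiff_mul_of_tsupport_subset {E : Type*} [NormedAddCommGroup E] [NormedSpace ℝ E]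
    {k : WithTop ℕ∞} {χ g : E → ℝ} {Ω : Set E} (hχ : ContDiff ℝ k χ) (hΩ : IsOpen Ω)
    (hs : tsupport χ ⊆ Ω) (hg : ContDiffOn ℝ k g Ω) : ContDiff ℝ k fun x => χ x * g x := by
  refine contDiff_iff_contDiffAt.2 fun x => ?_
  by_cases hx : x ∈ tsupport χ
  · exact hχ.contDiffAt.mul (hg.contDiffAt (hΩ.mem_nhds (hs hx)))
  · refine (contDiffAt_const (c := (0 : ℝ))).congr_of_eventuallyEq ?_
    filter_upwards [(isClosed_tsupport χ).isOpen_compl.mem_nhds hx] with y hy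
    rw [image_eq_zero_of_notMem_tsupport hy, zero_mul]

theorem lap_congr {u v : EuclideanSpace ℝ (Fin n) → ℝ} {x : EuclideanSpace ℝ (Fin n)}
    (h : u =ᶠ[𝓝 x] v) : lap u x = lap v x := by
  refine Finset.sum_congr rfl fun i _ => ?_
  have : (fun y => fderiv ℝ u y (EuclideanSpace.single i 1)) =ᶠ[𝓝 x]
      fun y => fderiv ℝ v y (EuclideanSpace.single i 1) :=
    (h.fderiv (𝕜 := ℝ)).mono fun y hy => by simp only [hy]
  rw [this.fderiv_eq]

theorem C2On01.contDiffOn {f f' f'' : ℝ → ℝ} (hf : C2On01 f f' f'') :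
    ContDiffOn ℝ 2 f (Ico 0 1) ∧ ContDiffOn ℝ 1 f' (Ico 0 1) := by
  have hU : UniqueDiffOn ℝ (Ico (0 : ℝ) 1) := uniqueDiffOn_Ico 0 1
  obtain ⟨h1, h2, h3⟩ := hf
  have c1 : ContDiffOn ℝ (0 + 1) f' (Ico 0 1) := by
    refine (contDiffOn_succ_iff_derivWithin hU).2
      ⟨fun t ht => (h2 t ht).differentiableWithinAt, by simp, ?_⟩
    exact contDiffOn_zero.2 (h3.congr fun t ht => (h2 t ht).derivWithin (hU t ht))
  rw [zero_add] at c1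
  refine ⟨?_, c1⟩
  rw [← one_add_one_eq_two]
  refine (contDiffOn_succ_iff_derivWithin hU).2
    ⟨fun t ht => (h1 t ht).differentiableWithinAt, by simp, ?_⟩
  exact c1.congr fun t ht => (h1 t ht).derivWithin (hU t ht)

theorem hasFDerivAt_comp_of_mem_Ico {g g' : ℝ → ℝ} {u : EuclideanSpace ℝ (Fin n) → ℝ}
    {Ω : Set (EuclideanSpace ℝ (Fin n))} (hΩ : IsOpen Ω)
    (hg : ∀ t ∈ Ico (0 : ℝ) 1, HasDerivWithinAt g (g' t) (Ico (0 : ℝ) 1) t)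
    (hu : ContDiffOn ℝ 2 u Ω) (h01 : MapsTo u Ω (Ico 0 1)) {x : EuclideanSpace ℝ (Fin n)}
    (hx : x ∈ Ω) : HasFDerivAt (fun y => g (u y)) (g' (u x) • fderiv ℝ u x) x :=
  (hg _ (h01 hx)).comp_hasFDerivAt_of_eq x
    (((hu.contDiffAt (hΩ.mem_nhds hx)).differentiableAt two_ne_zero).hasFDerivAt)
    (by filter_upwards [hΩ.mem_nhds hx] with y hy using h01 hy) rfl

theorem lap_comp {f f' f'' : ℝ → ℝ} {u : EuclideanSpace ℝ (Fin n) → ℝ}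
    {Ω : Set (EuclideanSpace ℝ (Fin n))} (hΩ : IsOpen Ω) (hf : C2On01 f f' f'')
    (hu : ContDiffOn ℝ 2 u Ω) (h01 : MapsTo u Ω (Ico 0 1)) {x : EuclideanSpace ℝ (Fin n)}
    (hx : x ∈ Ω) :
    lap (fun y => f (u y)) x = f'' (u x) * ‖gradient u x‖ ^ 2 + f' (u x) * lap u x := by
  have hD : DifferentiableAt ℝ (fderiv ℝ u) x := by
    have : ContDiffAt ℝ (1 + 1) u x := by
      rw [one_add_one_eq_two]
      exact hu.contDiffAt (hΩ.mem_nhds hx)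
    exact (this.fderiv_right le_rfl).differentiableAt one_ne_zero
  have key : ∀ i : Fin n,
      fderiv ℝ (fun y => fderiv ℝ (fun y => f (u y)) y (EuclideanSpace.single i 1)) x
        (EuclideanSpace.single i 1) =
      f'' (u x) * gradient u x i ^ 2 + f' (u x) *
        fderiv ℝ (fun y => fderiv ℝ u y (EuclideanSpace.single i 1)) x
          (EuclideanSpace.single i 1) := by
    intro i
    have h1 : (fun y => fderiv ℝ (fun y => f (u y)) y (EuclideanSpace.single i 1)) =ᶠ[𝓝 x]
        fun y => f' (u y) * fderiv ℝ u y (EuclideanSpace.single i 1) := by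
      filter_upwards [hΩ.mem_nhds hx] with y hy
      rw [(hasFDerivAt_comp_of_mem_Ico hΩ hf.1 hu h01 hy).fderiv]
      simp
    have h2 : HasFDerivAt (fun y => f' (u y)) (f'' (u x) • fderiv ℝ u x) x :=
      hasFDerivAt_comp_of_mem_Ico hΩ hf.2.1 hu h01 hx
    have h3 : DifferentiableAt ℝ (fun y => fderiv ℝ u y (EuclideanSpace.single i 1)) x :=
      hD.clm_apply (differentiableAt_const _)
    rw [h1.fderiv_eq, fderiv_fun_mul h2.differentiableAt h3, h2.fderiv,
      ← fderiv_single_eq_gradient]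
    simp only [add_apply, smul_apply, smul_eq_mul]
    ring
  simp only [lap]
  rw [Finset.sum_congr rfl fun i _ => key i, Finset.sum_add_distrib, ← Finset.mul_sum,
    ← Finset.mul_sum, EuclideanSpace.real_norm_sq_eq]

theorem exists_stablePair {θ K : ℝ} {f f' f'' : ℝ → ℝ} {u : EuclideanSpace ℝ (Fin n) → ℝ}
    (hf : C2On01 f f' f'') (hf0 : ∀ t ∈ Ico (0 : ℝ) 1, 0 ≤ f t)
    (hff : ∀ t ∈ Ico (0 : ℝ) 1, (1 + θ) * f' t ^ 2 - K ≤ f'' t * f t)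
    (hu : ContDiffOn ℝ 2 u (ball 0 1)) (h01 : ∀ x ∈ ball 0 1, 0 ≤ u x ∧ u x < 1)
    (heq : ∀ x ∈ ball 0 1, -lap u x = f (u x)) (hst : StableSol f' u (ball 0 1)) :
    ∃ U W : EuclideanSpace ℝ (Fin n) → ℝ, StablePair θ K U W ∧
      ∀ x ∈ ball 0 (3 / 4), U x = u x ∧ W x = f (u x) := by
  let χ : ContDiffBump (0 : EuclideanSpace ℝ (Fin n)) := ⟨4 / 5, 9 / 10, by norm_num, by norm_num⟩
  have hχs : tsupport χ ⊆ ball 0 1 := by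
    rw [χ.tsupport_eq]
    exact closedBall_subset_ball (by norm_num [χ])
  have hmaps : MapsTo u (ball 0 1) (Ico 0 1) := fun x hx => h01 x hx
  have hsub : ball (0 : EuclideanSpace ℝ (Fin n)) (3 / 4) ⊆ ball 0 1 :=
    ball_subset_ball (by norm_num)
  have hχ1 : ∀ x ∈ ball (0 : EuclideanSpace ℝ (Fin n)) (3 / 4), χ x = 1 := fun x hx =>
    χ.one_of_mem_closedBall (ball_subset_closedBall (ball_subset_ball (by norm_num [χ]) hx))
  have hχe : ∀ g : EuclideanSpace ℝ (Fin n) → ℝ,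
      ∀ x ∈ ball (0 : EuclideanSpace ℝ (Fin n)) (3 / 4), (fun y => χ y * g y) =ᶠ[𝓝 x] g := by
    intro g x hx
    filter_upwards [isOpen_ball.mem_nhds hx] with y hy
    rw [hχ1 y hy, one_mul]
  have hU : ContDiff ℝ 2 fun x => χ x * u x :=
    contDiff_mul_of_tsupport_subset χ.contDiff isOpen_ball hχs hu
  have hW : ContDiff ℝ 2 fun x => χ x * f (u x) :=
    contDiff_mul_of_tsupport_subset χ.contDiff isOpen_ball hχs (hf.contDiffOn.1.comp hu hmaps)
  have hc : ContDiff ℝ 1 fun x => χ x * f' (u x) :=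
    contDiff_mul_of_tsupport_subset χ.contDiff isOpen_ball hχs
      (hf.contDiffOn.2.comp (hu.of_le one_le_two) hmaps)
  have hlapU : ∀ x ∈ ball (0 : EuclideanSpace ℝ (Fin n)) (3 / 4),
      lap (fun y => χ y * u y) x = -f (u x) := fun x hx => by
    rw [lap_congr (hχe u x hx), ← heq x (hsub hx), neg_neg]
  have hlapW : ∀ x ∈ ball (0 : EuclideanSpace ℝ (Fin n)) (3 / 4),
      (1 + θ) * ‖gradient (fun y => χ y * f (u y)) x‖ ^ 2 -
        K * ‖gradient (fun y => χ y * u y) x‖ ^ 2 ≤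
      χ x * f (u x) * lap (fun y => χ y * f (u y)) x + χ x * f' (u x) * (χ x * f (u x)) ^ 2 := by
    intro x hx
    have e1 : gradient (fun y => χ y * f (u y)) x = f' (u x) • gradient u x := by
      rw [(hχe (fun y => f (u y)) x hx).gradient_eq, gradient,
        (hasFDerivAt_comp_of_mem_Ico isOpen_ball hf.1 hu hmaps (hsub hx)).fderiv]
      simp [gradient]
    rw [e1, (hχe u x hx).gradient_eq, lap_congr (hχe (fun y => f (u y)) x hx),
      lap_comp isOpen_ball hf hu hmaps (hsub hx), hχ1 x hx, norm_smul, mul_pow,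
      Real.norm_eq_abs, sq_abs]
    have h1 := heq x (hsub hx)
    have h2 : lap u x = -f (u x) := by linarith
    rw [h2]
    nlinarith [mul_le_mul_of_nonneg_right (hff _ (hmaps (hsub hx))) (sq_nonneg ‖gradient u x‖)]
  have hstab : ∀ ξ : EuclideanSpace ℝ (Fin n) → ℝ, ContDiff ℝ (⊤ : ℕ∞) ξ → HasCompactSupport ξ →
      tsupport ξ ⊆ ball 0 (3 / 4) →
      0 ≤ ∫ x in ball 0 (3 / 4), (‖gradient ξ x‖ ^ 2 - χ x * f' (u x) * ξ x ^ 2) := by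
    intro ξ h1 h2 h3
    have h := hst ξ h1 h2 (h3.trans hsub)
    have hz : ∀ x ∉ ball (0 : EuclideanSpace ℝ (Fin n)) (3 / 4),
        gradient ξ x = 0 ∧ ξ x = 0 := fun x hx =>
      ⟨gradient_eq_zero_of_notMem_tsupport fun h => hx (h3 h),
        image_eq_zero_of_notMem_tsupport fun h => hx (h3 h)⟩
    rw [setIntegral_eq_integral_of_forall_compl_eq_zero
      (fun x hx => by simp [hz x fun h => hx (hsub h)])] at h
    rw [setIntegral_eq_integral_of_forall_compl_eq_zero (fun x hx => by simp [hz x hx])]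
    convert h using 4 with x
    by_cases hx : x ∈ ball (0 : EuclideanSpace ℝ (Fin n)) (3 / 4)
    · rw [hχ1 x hx, one_mul]
    · simp [hz x hx]
  refine ⟨fun x => χ x * u x, fun x => χ x * f (u x),
    ⟨hU, hW, χ.hasCompactSupport.mul_right, fun x hx => mul_nonneg χ.nonneg (h01 x (hsub hx)).1,
      fun x hx => mul_nonneg χ.nonneg (hf0 _ (hmaps (hsub hx))), fun x hx => ?_, ?_⟩,
    fun x hx => by simp [hχ1 x hx]⟩
  · rw [hlapU x hx, hχ1 x hx, one_mul]
  · intro η hη hηc hηs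
    exact stab_of_lap_ge (c := fun x => χ x * f' (u x)) (hU.of_le one_le_two) hW hc.continuous
      hlapW (fun ξ h1 h2 h3 => stability_of_contDiff_one hc.continuous
        χ.hasCompactSupport.mul_right hstab h1 h2 h3) hη hηc hηs

end Reduction

section IntegralHelpers

variable {X : Type*} [MeasurableSpace X] {μ : Measure X}

theorem integrable_of_eq_zero_of_notMem_tsupport [TopologicalSpace X] [R1Space X]
    [OpensMeasurableSpace X] [IsFiniteMeasureOnCompacts μ] {F η : X → ℝ} (hF : Continuous F)
    (hη : HasCompactSupport η) (h : ∀ x ∉ tsupport η, F x = 0) : Integrable F μ :=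
  hF.integrable_of_hasCompactSupport <| HasCompactSupport.intro hη.isCompact h

theorem setIntegral_le_integral_of_le {s : Set X} {g h : X → ℝ} (hs : MeasurableSet s)
    (hg : IntegrableOn g s μ) (hh : Integrable h μ) (hle : ∀ x ∈ s, g x ≤ h x)
    (h0 : ∀ x, 0 ≤ h x) : ∫ x in s, g x ∂μ ≤ ∫ x, h x ∂μ :=
  (setIntegral_mono_on hg hh.integrableOn hs hle).trans
    (setIntegral_le_integral hh (Eventually.of_forall h0))

theorem integral_le_mul_setIntegral {s : Set X} {g h : X → ℝ} {C : ℝ} (hs : MeasurableSet s)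
    (hg : Integrable g μ) (hh : IntegrableOn h s μ) (hle : ∀ x ∈ s, g x ≤ C * h x)
    (h0 : ∀ x ∉ s, g x = 0) : ∫ x, g x ∂μ ≤ C * ∫ x in s, h x ∂μ := by
  rw [← setIntegral_eq_integral_of_forall_compl_eq_zero h0, ← integral_const_mul]
  exact setIntegral_mono_on hg.integrableOn (hh.const_mul C) hs hle

theorem Continuous.integrableOn_ball {E : Type*} [NormedAddCommGroup E] [NormedSpace ℝ E]
    [FiniteDimensional ℝ E] [MeasurableSpace E] [BorelSpace E] {μ : Measure E}
    [IsFiniteMeasureOnCompacts μ] {g : E → ℝ} (hg : Continuous g) (c : E) (r : ℝ) :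
    IntegrableOn g (ball c r) μ :=
  (hg.continuousOn.integrableOn_compact (isCompact_closedBall c r)).mono_set
    ball_subset_closedBall

end IntegralHelpers

section InteriorEstimate

variable {n : ℕ} {θ K : ℝ}

theorem StablePair.contDiff_one_left {u w : EuclideanSpace ℝ (Fin n) → ℝ}
    (h : StablePair θ K u w) : ContDiff ℝ 1 u := h.contDiff_left.of_le one_le_two

theorem StablePair.contDiff_one_right {u w : EuclideanSpace ℝ (Fin n) → ℝ}
    (h : StablePair θ K u w) : ContDiff ℝ 1 w := h.contDiff_right.of_le one_le_two

theorem exists_setIntegral_right_le (n : ℕ) (θ K : ℝ) :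
    ∃ C : ℝ, 0 < C ∧ ∀ u w : EuclideanSpace ℝ (Fin n) → ℝ, StablePair θ K u w →
      ∫ x in ball 0 (7 / 10), w x ≤ C * ∫ x in ball 0 (3 / 4), u x := by
  let φ : ContDiffBump (0 : EuclideanSpace ℝ (Fin n)) :=
    ⟨7 / 10, 18 / 25, by norm_num, by norm_num⟩
  have hφs : tsupport φ ⊆ ball 0 (3 / 4) := by
    rw [φ.tsupport_eq]
    exact closedBall_subset_ball (by norm_num [φ])
  have hφ2 : ContDiff ℝ 2 φ := φ.contDiff
  have hφ1 : ContDiff ℝ 1 φ := φ.contDiff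
  have cφ := hφ1.continuous
  have clφ := continuous_lap hφ2
  have hlc : HasCompactSupport (lap φ) :=
    HasCompactSupport.intro φ.hasCompactSupport.isCompact
      fun x hx => lap_eq_zero_of_notMem_tsupport hx
  obtain ⟨C, hC⟩ := hlc.exists_bound_of_continuous clφ
  refine ⟨|C| + 1, by positivity, fun u w h => ?_⟩
  have cu := h.contDiff_left.continuous
  have cw := h.contDiff_right.continuous
  have e1 : ∫ x, φ x * w x = -∫ x, u x * lap φ x := by
    have h1 := integral_mul_lap hφ1 φ.hasCompactSupport h.contDiff_left
    have h2 := integral_mul_lap h.contDiff_one_left h.hasCompactSupport_left hφ2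
    have hcomm : ∀ x, inner ℝ (gradient φ x) (gradient u x) =
        inner ℝ (gradient u x) (gradient φ x) := fun x => real_inner_comm _ _
    simp only [hcomm] at h1
    have h3 : ∀ x, φ x * lap u x = -(φ x * w x) := fun x => by
      by_cases hx : x ∈ ball (0 : EuclideanSpace ℝ (Fin n)) (3 / 4)
      · rw [h.lap_eq x hx, mul_neg]
      · rw [image_eq_zero_of_notMem_tsupport fun h => hx (hφs h)]
        simp
    simp only [h3, integral_neg] at h1
    linarith
  calc ∫ x in ball 0 (7 / 10), w x ≤ ∫ x, φ x * w x := by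
        refine setIntegral_le_integral_of_le measurableSet_ball (cw.integrableOn_ball _ _)
          ((cφ.mul cw).integrable_of_hasCompactSupport φ.hasCompactSupport.mul_right)
          (fun x hx => ?_) fun x => ?_
        · rw [φ.one_of_mem_closedBall (ball_subset_closedBall hx), one_mul]
        · by_cases hx : x ∈ ball (0 : EuclideanSpace ℝ (Fin n)) (3 / 4)
          · exact mul_nonneg φ.nonneg (h.nonneg_right x hx)
          · rw [image_eq_zero_of_notMem_tsupport fun h => hx (hφs h), zero_mul]
    _ = ∫ x, -(u x * lap φ x) := by rw [e1, integral_neg]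
    _ ≤ _ := by
        refine integral_le_mul_setIntegral measurableSet_ball
          ((cu.mul clφ).integrable_of_hasCompactSupport hlc.mul_left).neg
          (cu.integrableOn_ball _ _) (fun x hx => ?_) fun x hx => ?_
        · have h1 := h.nonneg_left x hx
          have h2 := (neg_le_abs _).trans ((hC x).trans (le_abs_self C))
          nlinarith
        · rw [lap_eq_zero_of_notMem_tsupport fun h => hx (hφs h)]
          simp

theorem exists_integral_abs_pow_three_le (n : ℕ) (hn3 : 3 ≤ n) (hn6 : n ≤ 6) :
    ∃ C : ℝ, 0 < C ∧ ∀ v : EuclideanSpace ℝ (Fin n) → ℝ, ContDiff ℝ 1 v → HasCompactSupport v →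
      tsupport v ⊆ ball 0 1 →
      ∫ x, |v x| ^ 3 ≤ C * √(∫ x, ‖gradient v x‖ ^ 2) ^ 3 := by
  let c : NNReal := eLpNormLESNormFDerivOfLeConst ℝ
    (volume : Measure (EuclideanSpace ℝ (Fin n))) (ball 0 1) 2 3
  refine ⟨(c : ℝ) ^ 3 + 1, by positivity, fun v hv hvc hvs => ?_⟩
  have hsob := eLpNorm_le_eLpNorm_fderiv_of_le
    (volume : Measure (EuclideanSpace ℝ (Fin n))) (F := ℝ) hv ((subset_tsupport v).trans hvs)
    (p := 2) (q := 3) one_le_two (by simp; omega) (by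
      have h1 : (0 : ℝ) < n := by positivity
      have h2 : (n : ℝ) ≤ 6 := by exact_mod_cast hn6
      have h3 : (6 : ℝ)⁻¹ ≤ (n : ℝ)⁻¹ := inv_anti₀ h1 h2
      simp only [finrank_euclideanSpace, Fintype.card_fin]
      push_cast
      linarith) isBounded_ball
  have m1 : MemLp v 3 := hv.continuous.memLp_of_hasCompactSupport hvc
  have m2 : MemLp (fderiv ℝ v) 2 :=
    (hv.continuous_fderiv one_ne_zero).memLp_of_hasCompactSupport (hvc.fderiv ℝ)
  have e1 := m1.eLpNorm_eq_integral_rpow_norm (by norm_num) (by norm_num)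
  have e2 := m2.eLpNorm_eq_integral_rpow_norm (by norm_num) (by norm_num)
  simp only [ENNReal.toReal_ofNat] at e1 e2
  have hsob' : eLpNorm v 3 volume ≤ c * eLpNorm (fderiv ℝ v) 2 volume := hsob
  rw [e1, e2] at hsob'
  have hN : (0 : ℝ) ≤ ∫ x, ‖gradient v x‖ ^ 2 := integral_nonneg fun x => by positivity
  have hN3 : (0 : ℝ) ≤ ∫ x, |v x| ^ 3 := integral_nonneg fun x => by positivity
  have r1 : ∫ x, ‖v x‖ ^ (3 : ℝ) = ∫ x, |v x| ^ 3 := by norm_cast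
  have r2 : ∫ x, ‖fderiv ℝ v x‖ ^ (2 : ℝ) = ∫ x, ‖gradient v x‖ ^ 2 := by
    simp only [norm_gradient]
    norm_cast
  rw [r1, r2, ← ENNReal.ofReal_coe_nnreal, ← ENNReal.ofReal_mul (by positivity),
    ENNReal.ofReal_le_ofReal_iff (by positivity)] at hsob'
  have hs : (∫ x, ‖gradient v x‖ ^ 2) ^ (2 : ℝ)⁻¹ = √(∫ x, ‖gradient v x‖ ^ 2) := by
    rw [Real.sqrt_eq_rpow, one_div]
  rw [hs] at hsob'
  have h3 := pow_le_pow_left₀ (by positivity) hsob' 3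
  have h4 : ((∫ x, |v x| ^ 3) ^ (3 : ℝ)⁻¹) ^ 3 = ∫ x, |v x| ^ 3 := by
    have := Real.rpow_inv_natCast_pow hN3 (n := 3) (by norm_num)
    exact_mod_cast this
  rw [h4, mul_pow] at h3
  have : 0 ≤ √(∫ x, ‖gradient v x‖ ^ 2) ^ 3 := by positivity
  linarith

theorem StablePair.integral_gradient_left_le {u w : EuclideanSpace ℝ (Fin n) → ℝ}
    (h : StablePair θ K u w) {η : EuclideanSpace ℝ (Fin n) → ℝ} (hη : ContDiff ℝ 1 η)
    (hηc : HasCompactSupport η) (hηs : tsupport η ⊆ ball 0 (3 / 4)) :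
    ∫ x, ‖gradient u x‖ ^ 2 * η x ^ 2 ≤
      2 * (∫ x, u x * w x * η x ^ 2) + 4 * ∫ x, u x ^ 2 * ‖gradient η x‖ ^ 2 := by
  have hu1 := h.contDiff_one_left
  have cu := h.contDiff_left.continuous
  have cw := h.contDiff_right.continuous
  have cη := hη.continuous
  have cgu := continuous_gradient hu1
  have cgη := continuous_gradient hη
  have hg : ContDiff ℝ 1 fun x => u x * η x ^ 2 := hu1.mul (hη.pow 2)
  have hz : ∀ x ∉ tsupport η, η x = 0 ∧ gradient η x = 0 := fun x hx =>
    ⟨image_eq_zero_of_notMem_tsupport hx, gradient_eq_zero_of_notMem_tsupport hx⟩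
  have hgc : HasCompactSupport fun x => u x * η x ^ 2 :=
    HasCompactSupport.intro hηc.isCompact fun x hx => by simp [hz x hx]
  have hibp := integral_mul_lap hg hgc h.contDiff_left
  have e1 : ∀ x, u x * η x ^ 2 * lap u x = -(u x * w x * η x ^ 2) := fun x => by
    by_cases hx : x ∈ tsupport η
    · rw [h.lap_eq x (hηs hx)]
      ring
    · simp [hz x hx]
  have e2 : ∀ x, inner ℝ (gradient (fun x => u x * η x ^ 2) x) (gradient u x) =
      2 * (u x * η x * inner ℝ (gradient η x) (gradient u x)) +
        ‖gradient u x‖ ^ 2 * η x ^ 2 := fun x => by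
    have d1 := hu1.differentiable one_ne_zero x
    have d2 := hη.differentiable one_ne_zero x
    have d3 : DifferentiableAt ℝ (fun y => η y ^ 2) x := d2.pow 2
    rw [gradient_fun_mul d1 d3, gradient_fun_pow d2]
    simp only [inner_add_left, real_inner_smul_left, real_inner_self_eq_norm_sq, smul_smul]
    push_cast
    ring
  simp only [e1, e2, integral_neg] at hibp
  have i1 : Integrable fun x => ‖gradient u x‖ ^ 2 * η x ^ 2 :=
    integrable_of_eq_zero_of_notMem_tsupport (by fun_prop) hηc fun x hx => by simp [hz x hx]
  have i2 : Integrable fun x => u x ^ 2 * ‖gradient η x‖ ^ 2 :=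
    integrable_of_eq_zero_of_notMem_tsupport (by fun_prop) hηc fun x hx => by simp [hz x hx]
  have i3 : Integrable fun x => 2 * (u x * η x * inner ℝ (gradient η x) (gradient u x)) +
        ‖gradient u x‖ ^ 2 * η x ^ 2 :=
    integrable_of_eq_zero_of_notMem_tsupport (by fun_prop) hηc fun x hx => by simp [hz x hx]
  have key : ∫ x, (1 / 2 * (‖gradient u x‖ ^ 2 * η x ^ 2) -
      2 * (u x ^ 2 * ‖gradient η x‖ ^ 2)) ≤
      ∫ x, (2 * (u x * η x * inner ℝ (gradient η x) (gradient u x)) +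
        ‖gradient u x‖ ^ 2 * η x ^ 2) := by
    refine integral_mono ((i1.const_mul _).sub (i2.const_mul _)) i3 fun x => ?_
    have h1 : 0 ≤ ‖(2 * u x) • gradient η x + η x • gradient u x‖ ^ 2 := sq_nonneg _
    rw [norm_add_sq_real] at h1
    simp only [real_inner_smul_left, real_inner_smul_right, norm_smul, mul_pow,
      Real.norm_eq_abs, sq_abs] at h1
    simp only
    linarith
  rw [integral_sub (i1.const_mul _) (i2.const_mul _), integral_const_mul, integral_const_mul]
    at key
  linarith

end InteriorEstimate

section InteriorEstimate

variable {n : ℕ} {θ K : ℝ}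

theorem StablePair.integral_gradient_cutoff_le {u w : EuclideanSpace ℝ (Fin n) → ℝ}
    (h : StablePair θ K u w) (hθ : 0 < θ) (hK : 0 ≤ K) {ψ : EuclideanSpace ℝ (Fin n) → ℝ} {L : ℝ}
    (hψ : ContDiff ℝ 1 ψ) (hψc : HasCompactSupport ψ) (hψs : tsupport ψ ⊆ ball 0 (3 / 4))
    (hψ0 : ∀ x, 0 ≤ ψ x) (hψ1 : ∀ x, ψ x ≤ 1) (hL : ∀ x, ‖gradient ψ x‖ ^ 2 ≤ L) :
    ∫ x, ‖gradient u x‖ ^ 2 * (ψ x ^ 4) ^ 2 ≤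
        (2 + 64 * L) * ∫ x, (u x + w x) ^ 2 * ψ x ^ 6 ∧
      ∫ x, ‖gradient (fun y => (u y + w y) * ψ y ^ 4) x‖ ^ 2 ≤
        (96 * L + 4 * (1 + K) * (2 + 64 * L)) * ∫ x, (u x + w x) ^ 2 * ψ x ^ 6 := by
  have hu1 := h.contDiff_one_left
  have hw1 := h.contDiff_one_right
  have cu := hu1.continuous
  have cw := hw1.continuous
  have cψ := hψ.continuous
  have cgu := continuous_gradient hu1
  have cgw := continuous_gradient hw1
  have hη : ContDiff ℝ 1 fun x => ψ x ^ 4 := hψ.pow 4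
  have cη := hη.continuous
  have cgη := continuous_gradient hη
  have hz : ∀ x ∉ tsupport ψ, ψ x = 0 := fun x hx => image_eq_zero_of_notMem_tsupport hx
  have hηt : tsupport (fun x => ψ x ^ 4) ⊆ tsupport ψ :=
    closure_mono fun x hx hx0 => hx (by simp [hx0])
  have hηc : HasCompactSupport fun x => ψ x ^ 4 :=
    HasCompactSupport.intro hψc.isCompact fun x hx => by simp [hz x hx]
  have hgη : ∀ x, ‖gradient (fun y => ψ y ^ 4) x‖ ^ 2 ≤ 16 * L * ψ x ^ 6 := fun x => by
    rw [gradient_fun_pow (hψ.differentiable one_ne_zero x), norm_smul, mul_pow]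
    have h6 : 0 ≤ ψ x ^ 6 := pow_nonneg (hψ0 x) 6
    simp only [Real.norm_eq_abs, sq_abs]
    push_cast
    calc (4 * ψ x ^ 3) ^ 2 * ‖gradient ψ x‖ ^ 2 = 16 * ψ x ^ 6 * ‖gradient ψ x‖ ^ 2 := by ring
      _ ≤ 16 * ψ x ^ 6 * L := mul_le_mul_of_nonneg_left (hL x) (by positivity)
      _ = _ := by ring
  have hgz : ∀ x ∉ tsupport ψ, gradient (fun y => ψ y ^ 4) x = 0 := fun x hx =>
    gradient_eq_zero_of_notMem_tsupport fun h => hx (hηt h)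
  have h86 : ∀ x, (ψ x ^ 4) ^ 2 ≤ ψ x ^ 6 := fun x => by
    rw [← pow_mul]
    exact pow_le_pow_of_le_one (hψ0 x) (hψ1 x) (by norm_num)
  have hpos : ∀ x, ψ x ≠ 0 → 0 ≤ u x ∧ 0 ≤ w x := fun x hx =>
    have hx' := hψs (subset_tsupport ψ hx)
    ⟨h.nonneg_left x hx', h.nonneg_right x hx'⟩
  have int : ∀ {F : EuclideanSpace ℝ (Fin n) → ℝ}, Continuous F → (∀ x ∉ tsupport ψ, F x = 0) →
      Integrable F := fun hF h0 => integrable_of_eq_zero_of_notMem_tsupport hF hψc h0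
  set Z := ∫ x, (u x + w x) ^ 2 * ψ x ^ 6 with hZ
  set G := ∫ x, ‖gradient u x‖ ^ 2 * (ψ x ^ 4) ^ 2 with hG
  set B := ∫ x, ‖gradient w x‖ ^ 2 * (ψ x ^ 4) ^ 2 with hB
  have iZ : Integrable fun x => (u x + w x) ^ 2 * ψ x ^ 6 :=
    int (by fun_prop) fun x hx => by simp [hz x hx]
  have iG : Integrable fun x => ‖gradient u x‖ ^ 2 * (ψ x ^ 4) ^ 2 :=
    int (by fun_prop) fun x hx => by simp [hz x hx]
  have iB : Integrable fun x => ‖gradient w x‖ ^ 2 * (ψ x ^ 4) ^ 2 :=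
    int (by fun_prop) fun x hx => by simp [hz x hx]
  have cmp : ∀ {g : EuclideanSpace ℝ (Fin n) → ℝ}, Continuous g →
      (∀ x, ψ x ≠ 0 → g x ^ 2 ≤ (u x + w x) ^ 2) →
      ∫ x, g x ^ 2 * ‖gradient (fun y => ψ y ^ 4) x‖ ^ 2 ≤ 16 * L * Z := by
    intro g cg hg
    rw [hZ, ← integral_const_mul]
    refine integral_mono (int (by fun_prop) fun x hx => by simp [hgz x hx]) (iZ.const_mul _)
      fun x => ?_
    have h6 : 0 ≤ ψ x ^ 6 := pow_nonneg (hψ0 x) 6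
    by_cases hx : ψ x = 0
    · have := hgη x
      simp only [hx, ne_eq, OfNat.ofNat_ne_zero, not_false_eq_true, zero_pow, mul_zero] at this ⊢
      have h0 := le_antisymm this (sq_nonneg _)
      simp [h0]
    · calc g x ^ 2 * ‖gradient (fun y => ψ y ^ 4) x‖ ^ 2
          ≤ (u x + w x) ^ 2 * (16 * L * ψ x ^ 6) :=
            mul_le_mul (hg x hx) (hgη x) (sq_nonneg _) (sq_nonneg _)
        _ = _ := by ring
  have hcu := cmp cu fun x hx => by
    obtain ⟨h1, h2⟩ := hpos x hx
    nlinarith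
  have hcw := cmp cw fun x hx => by
    obtain ⟨h1, h2⟩ := hpos x hx
    nlinarith
  have hcv := cmp (g := fun x => u x + w x) (cu.add cw) fun x _ => le_rfl
  have hGle : G ≤ (2 + 64 * L) * Z := by
    have h1 := h.integral_gradient_left_le hη hηc (hηt.trans hψs)
    have h2 : ∫ x, u x * w x * (ψ x ^ 4) ^ 2 ≤ Z := by
      refine integral_mono (int (by fun_prop) fun x hx => by simp [hz x hx]) iZ fun x => ?_
      by_cases hx : ψ x = 0
      · simp [hx]
      · obtain ⟨h1, h2⟩ := hpos x hx
        exact mul_le_mul (by nlinarith) (h86 x) (by positivity) (by positivity)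
    linarith
  have hBle : (1 + θ) * B ≤ 16 * L * Z + K * G :=
    (h.stab _ hη hηc (hηt.trans hψs)).trans (by gcongr)
  have hB0 : 0 ≤ B := integral_nonneg fun x => by positivity
  refine ⟨hGle, ?_⟩
  have hD : ∫ x, ‖gradient (fun y => (u y + w y) * ψ y ^ 4) x‖ ^ 2 ≤
      ∫ x, (2 * ((u x + w x) ^ 2 * ‖gradient (fun y => ψ y ^ 4) x‖ ^ 2) +
        (4 * (‖gradient u x‖ ^ 2 * (ψ x ^ 4) ^ 2) +
          4 * (‖gradient w x‖ ^ 2 * (ψ x ^ 4) ^ 2))) := by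
    have hv : ContDiff ℝ 1 fun y => (u y + w y) * ψ y ^ 4 := (hu1.add hw1).mul hη
    have cgv := continuous_gradient hv
    have hvt : tsupport (fun y => (u y + w y) * ψ y ^ 4) ⊆ tsupport ψ :=
      closure_mono fun x hx hx0 => hx (by simp [hx0])
    refine integral_mono (int (by fun_prop) fun x hx => ?_) (int (by fun_prop) fun x hx => ?_)
      fun x => ?_
    · rw [gradient_eq_zero_of_notMem_tsupport fun h => hx (hvt h)]
      simp
    · simp [hz x hx, hgz x hx]
    have d1 := hu1.differentiable one_ne_zero x
    have d2 := hw1.differentiable one_ne_zero x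
    have d12 : DifferentiableAt ℝ (fun y => u y + w y) x := d1.add d2
    rw [gradient_fun_mul d12 (hη.differentiable one_ne_zero x), gradient_fun_add d1 d2]
    have p1 := parallelogram_law_with_norm ℝ
      ((u x + w x) • gradient (fun y => ψ y ^ 4) x) (ψ x ^ 4 • (gradient u x + gradient w x))
    have p2 := parallelogram_law_with_norm ℝ (gradient u x) (gradient w x)
    have q1 := mul_self_nonneg ‖(u x + w x) • gradient (fun y => ψ y ^ 4) x -
      ψ x ^ 4 • (gradient u x + gradient w x)‖
    have q2 := mul_nonneg (sq_nonneg (ψ x ^ 4)) (mul_self_nonneg ‖gradient u x - gradient w x‖)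
    have n1 : ‖(u x + w x) • gradient (fun y => ψ y ^ 4) x‖ ^ 2 =
        (u x + w x) ^ 2 * ‖gradient (fun y => ψ y ^ 4) x‖ ^ 2 := by
      rw [norm_smul, mul_pow, Real.norm_eq_abs, sq_abs]
    have n2 : ‖ψ x ^ 4 • (gradient u x + gradient w x)‖ ^ 2 =
        (ψ x ^ 4) ^ 2 * ‖gradient u x + gradient w x‖ ^ 2 := by
      rw [norm_smul, mul_pow, Real.norm_eq_abs, sq_abs]
    simp only [← sq] at p1 p2 q1 q2
    rw [n1, n2] at p1
    have p3 := congrArg (fun t => (ψ x ^ 4) ^ 2 * t) p2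
    linarith
  rw [integral_add, integral_add, integral_const_mul, integral_const_mul, integral_const_mul,
    ← hG, ← hB] at hD
  rotate_left
  · exact iG.const_mul _
  · exact iB.const_mul _
  · exact int (by fun_prop) fun x hx => by simp [hgz x hx]
  · exact (iG.const_mul _).add (iB.const_mul _)
  have hKG := mul_le_mul_of_nonneg_left hGle hK
  have hθB : 0 ≤ θ * B := by positivity
  linarith

theorem le_sq_mul_sq_of_interpolation {Z I S M : ℝ} (hZ : 0 ≤ Z) (hS : 0 < S)
    (hI : I ≤ S * √Z ^ 3) (h : ∀ t > 0, 2 * t * Z ≤ t ^ 2 * I + M) : Z ≤ S ^ 2 * M ^ 2 := by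
  rcases hZ.eq_or_lt with rfl | hZ
  · positivity
  have hr : 0 < √Z := Real.sqrt_pos.2 hZ
  have hrZ : √Z ^ 2 = Z := Real.sq_sqrt hZ.le
  have h1 := h (1 / (S * √Z)) (by positivity)
  have h2 : (1 / (S * √Z)) ^ 2 * I ≤ (1 / (S * √Z)) ^ 2 * (S * √Z ^ 3) := by gcongr
  have h3 : (1 / (S * √Z)) ^ 2 * (S * √Z ^ 3) = √Z / S := by field_simp
  have h4 : 2 * (1 / (S * √Z)) * Z = 2 * (√Z / S) := by
    rw [← hrZ, Real.sqrt_sq hr.le]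
    field_simp
  have h5 : √Z / S ≤ M := by linarith
  rw [div_le_iff₀ hS] at h5
  calc Z = √Z ^ 2 := hrZ.symm
    _ ≤ (M * S) ^ 2 := by gcongr
    _ = _ := by ring

theorem exists_setIntegral_ball_half_le (n : ℕ) (hn3 : 3 ≤ n) (hn6 : n ≤ 6) (θ K : ℝ)
    (hθ : 0 < θ) (hK : 0 ≤ K) :
    ∃ C : ℝ, 0 < C ∧ ∀ u w : EuclideanSpace ℝ (Fin n) → ℝ, StablePair θ K u w →
      ∫ x in ball 0 (1 / 2), ((u x + w x) ^ 2 + ‖gradient u x‖ ^ 2) ≤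
        C * (∫ x in ball 0 (3 / 4), u x) ^ 2 := by
  let ψ : ContDiffBump (0 : EuclideanSpace ℝ (Fin n)) :=
    ⟨1 / 2, 3 / 5, by norm_num, by norm_num⟩
  have hψt : tsupport ψ = closedBall 0 (3 / 5) := ψ.tsupport_eq
  have hψ7 : tsupport ψ ⊆ ball 0 (7 / 10) := by
    rw [hψt]
    exact closedBall_subset_ball (by norm_num)
  have hψs : tsupport ψ ⊆ ball 0 (3 / 4) := hψ7.trans (ball_subset_ball (by norm_num))
  have hψ1 : ContDiff ℝ 1 ψ := ψ.contDiff
  have cψ := hψ1.continuous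
  have cgψ := continuous_gradient hψ1
  have hz : ∀ x ∉ tsupport ψ, ψ x = 0 := fun x hx => image_eq_zero_of_notMem_tsupport hx
  obtain ⟨L₀, hL₀⟩ := (hasCompactSupport_gradient
    ψ.hasCompactSupport).exists_bound_of_continuous cgψ
  have hL : ∀ x, ‖gradient ψ x‖ ^ 2 ≤ L₀ ^ 2 := fun x =>
    pow_le_pow_left₀ (norm_nonneg _) (hL₀ x) 2
  obtain ⟨C₁, hC₁, hw⟩ := exists_setIntegral_right_le n θ K
  obtain ⟨S, hS, hsob⟩ := exists_integral_abs_pow_three_le n hn3 hn6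
  have hL0 := sq_nonneg L₀
  set L := L₀ ^ 2
  set c := 96 * L + 4 * (1 + K) * (2 + 64 * L)
  have hc : 0 < c := by positivity
  refine ⟨(3 + 64 * L) * ((S * √c ^ 3) ^ 2 * (1 + C₁) ^ 2), by positivity, fun u w h => ?_⟩
  obtain ⟨hG, hD⟩ := h.integral_gradient_cutoff_le hθ hK hψ1 ψ.hasCompactSupport hψs
    (fun x => ψ.nonneg) (fun x => ψ.le_one) hL
  have hu1 := h.contDiff_one_left
  have hw1 := h.contDiff_one_right
  have cu := hu1.continuous
  have cw := hw1.continuous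
  have cgu := continuous_gradient hu1
  have int : ∀ {F : EuclideanSpace ℝ (Fin n) → ℝ}, Continuous F → (∀ x ∉ tsupport ψ, F x = 0) →
      Integrable F := fun hF h0 =>
    integrable_of_eq_zero_of_notMem_tsupport hF ψ.hasCompactSupport h0
  set Z := ∫ x, (u x + w x) ^ 2 * ψ x ^ 6 with hZ
  set M := ∫ x in ball 0 (3 / 4), u x with hM
  have iZ : Integrable fun x => (u x + w x) ^ 2 * ψ x ^ 6 :=
    int (by fun_prop) fun x hx => by simp [hz x hx]
  have hZ0 : 0 ≤ Z := integral_nonneg fun x => by positivity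
  have hv : ContDiff ℝ 1 fun y => (u y + w y) * ψ y ^ 4 := (hu1.add hw1).mul (hψ1.pow 4)
  have hvt : tsupport (fun y => (u y + w y) * ψ y ^ 4) ⊆ tsupport ψ :=
    closure_mono fun x hx hx0 => hx (by simp [hx0])
  have hI := hsob _ hv (ψ.hasCompactSupport.isCompact.of_isClosed_subset (isClosed_tsupport _) hvt) (hvt.trans
    (hψs.trans (ball_subset_ball (by norm_num))))
  have iI : Integrable fun x => |(u x + w x) * ψ x ^ 4| ^ 3 :=
    int (by fun_prop) fun x hx => by simp [hz x hx]
  have hMp : ∫ x in ball 0 (7 / 10), (u x + w x) ≤ (1 + C₁) * M := by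
    rw [integral_add (cu.integrableOn_ball _ _) (cw.integrableOn_ball _ _)]
    have h1 : ∫ x in ball 0 (7 / 10), u x ≤ M :=
      setIntegral_mono_set (cu.integrableOn_ball _ _)
        ((ae_restrict_iff' measurableSet_ball).2 (Eventually.of_forall h.nonneg_left))
        (ball_subset_ball (by norm_num)).eventuallyLE
    linarith [hw u w h]
  have hpos : ∀ x ∈ ball (0 : EuclideanSpace ℝ (Fin n)) (7 / 10), 0 ≤ u x + w x := fun x hx =>
    have hx' := ball_subset_ball (by norm_num) hx
    add_nonneg (h.nonneg_left x hx') (h.nonneg_right x hx')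
  have hint : ∀ t > 0, 2 * t * Z ≤ t ^ 2 * (∫ x, |(u x + w x) * ψ x ^ 4| ^ 3) +
      (1 + C₁) * M := by
    intro t ht
    have h1 : ∫ x, (2 * t * ((u x + w x) ^ 2 * ψ x ^ 6) -
        t ^ 2 * |(u x + w x) * ψ x ^ 4| ^ 3) ≤ 1 * ∫ x in ball 0 (7 / 10), (u x + w x) := by
      refine integral_le_mul_setIntegral measurableSet_ball
        ((iZ.const_mul _).sub (iI.const_mul _)) ((cu.add cw).integrableOn_ball _ _)
        (fun x hx => ?_) fun x hx => ?_
      · have hv0 := hpos x hx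
        have hψ0 : 0 ≤ ψ x := ψ.nonneg
        rw [abs_of_nonneg (by positivity)]
        have := mul_nonneg hv0 (sq_nonneg (1 - t * (u x + w x) * ψ x ^ 6))
        linarith
      · simp [hz x fun h => hx (hψ7 h)]
    rw [integral_sub (iZ.const_mul _) (iI.const_mul _), integral_const_mul,
      integral_const_mul] at h1
    linarith
  have hZle : Z ≤ (S * √c ^ 3) ^ 2 * ((1 + C₁) * M) ^ 2 := by
    refine le_sq_mul_sq_of_interpolation hZ0 (by positivity) (hI.trans ?_) hint
    rw [mul_assoc, ← mul_pow, ← Real.sqrt_mul hc.le]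
    gcongr
  calc ∫ x in ball 0 (1 / 2), ((u x + w x) ^ 2 + ‖gradient u x‖ ^ 2)
      ≤ ∫ x, ((u x + w x) ^ 2 * ψ x ^ 6 + ‖gradient u x‖ ^ 2 * (ψ x ^ 4) ^ 2) := by
        refine setIntegral_le_integral_of_le measurableSet_ball
          (Continuous.integrableOn_ball (by fun_prop) _ _)
          (int (by fun_prop) fun x hx => by simp [hz x hx]) (fun x hx => ?_)
          fun x => by positivity
        rw [ψ.one_of_mem_closedBall (ball_subset_closedBall hx)]
        simp
    _ = Z + ∫ x, ‖gradient u x‖ ^ 2 * (ψ x ^ 4) ^ 2 :=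
        integral_add iZ (int (by fun_prop) fun x hx => by simp [hz x hx])
    _ ≤ (3 + 64 * L) * Z := by linarith
    _ ≤ (3 + 64 * L) * ((S * √c ^ 3) ^ 2 * ((1 + C₁) * M) ^ 2) := by gcongr
    _ = _ := by ring

end InteriorEstimate

section RegWeight

variable {n : ℕ} {ε a : ℝ}

/-- The regularised radial weight `(|x|² + ε)^a`. -/
noncomputable def regWeight (ε a : ℝ) (x : EuclideanSpace ℝ (Fin n)) : ℝ := (‖x‖ ^ 2 + ε) ^ a

theorem regWeight_pos (hε : 0 < ε) (a : ℝ) (x : EuclideanSpace ℝ (Fin n)) :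
    0 < regWeight ε a x := Real.rpow_pos_of_pos (by positivity) a

theorem contDiff_regWeight (hε : 0 < ε) (a : ℝ) :
    ContDiff ℝ 1 (regWeight ε a : EuclideanSpace ℝ (Fin n) → ℝ) :=
  ((contDiff_norm_sq ℝ).add contDiff_const).rpow_const_of_ne fun x => by positivity

theorem gradient_regWeight (hε : 0 < ε) (a : ℝ) (x : EuclideanSpace ℝ (Fin n)) :
    gradient (regWeight ε a) x = (2 * a * regWeight ε (a - 1) x) • x := by
  have h1 : HasFDerivAt (fun y : EuclideanSpace ℝ (Fin n) => ‖y‖ ^ 2 + ε)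
      (2 • innerSL ℝ x) x := (hasStrictFDerivAt_norm_sq x).hasFDerivAt.add_const ε
  have h2 := h1.rpow_const (p := a) (Or.inl (by positivity))
  refine HasGradientAt.gradient (hasGradientAt_iff_hasFDerivAt.2 ?_)
  refine h2.congr_fderiv ?_
  ext y
  simp [regWeight, InnerProductSpace.toDual_apply_apply]
  ring

theorem regWeight_sub_one_mul (hε : 0 < ε) (a : ℝ) (x : EuclideanSpace ℝ (Fin n)) :
    regWeight ε (a - 1) x * (‖x‖ ^ 2 + ε) = regWeight ε a x := by
  have : 0 < ‖x‖ ^ 2 + ε := by positivity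
  rw [regWeight, Real.rpow_sub_one this.ne', div_mul_cancel₀ _ this.ne', regWeight]

theorem norm_sq_mul_regWeight_sub_one_le (hε : 0 < ε) (a : ℝ) (x : EuclideanSpace ℝ (Fin n)) :
    ‖x‖ ^ 2 * regWeight ε (a - 1) x ≤ regWeight ε a x := by
  rw [← regWeight_sub_one_mul hε a]
  nlinarith [regWeight_pos hε (a - 1) x]

theorem regWeight_mul_regWeight (hε : 0 < ε) (a b : ℝ) (x : EuclideanSpace ℝ (Fin n)) :
    regWeight ε a x * regWeight ε b x = regWeight ε (a + b) x :=
  (Real.rpow_add (by positivity) a b).symm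

theorem regWeight_le_sixteen (hε : 0 < ε) (hε1 : ε ≤ 1) (ha : |a| ≤ 1)
    {x : EuclideanSpace ℝ (Fin n)} (hx : 1 / 4 ≤ ‖x‖) (hx1 : ‖x‖ ≤ 1) :
    regWeight ε a x ≤ 16 := by
  have h0 : 0 < ‖x‖ ^ 2 + ε := by positivity
  obtain ⟨ha1, ha2⟩ := abs_le.1 ha
  rcases le_total 1 (‖x‖ ^ 2 + ε) with h | h
  · have := Real.rpow_le_rpow_of_exponent_le h ha2
    rw [Real.rpow_one] at this
    exact this.trans (by nlinarith)
  · have := Real.rpow_le_rpow_of_exponent_ge h0 h ha1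
    rw [Real.rpow_neg_one] at this
    refine this.trans (inv_le_of_inv_le₀ (by norm_num) ?_)
    nlinarith

theorem regWeight_le_two (hε : 0 < ε) (hε1 : ε ≤ 1) (ha : 0 ≤ a) (ha1 : a ≤ 1)
    {x : EuclideanSpace ℝ (Fin n)} (hx1 : ‖x‖ ≤ 1) : regWeight ε a x ≤ 2 := by
  have h1 : ‖x‖ ^ 2 + ε ≤ 2 := by nlinarith [norm_nonneg x]
  calc regWeight ε a x ≤ 2 ^ a := Real.rpow_le_rpow (by positivity) h1 ha
    _ ≤ 2 ^ (1 : ℝ) := Real.rpow_le_rpow_of_exponent_le one_le_two ha1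
    _ = 2 := Real.rpow_one 2

theorem divg_smul_id {g : EuclideanSpace ℝ (Fin n) → ℝ} {x : EuclideanSpace ℝ (Fin n)}
    (hg : DifferentiableAt ℝ g x) :
    divg (fun y => g y • y) x = n * g x + inner ℝ (gradient g x) x := by
  have h1 : ∀ i : Fin n, fderiv ℝ (fun y : EuclideanSpace ℝ (Fin n) => (g y • y) i) x
      (EuclideanSpace.single i 1) = g x + gradient g x i * x i := fun i => by
    have h2 : HasFDerivAt (fun y : EuclideanSpace ℝ (Fin n) => y i)
        (EuclideanSpace.proj i : EuclideanSpace ℝ (Fin n) →L[ℝ] ℝ) x :=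
      (EuclideanSpace.proj i : EuclideanSpace ℝ (Fin n) →L[ℝ] ℝ).hasFDerivAt
    have h3 := hg.hasFDerivAt.mul h2
    have h4 : (fun y : EuclideanSpace ℝ (Fin n) => (g y • y) i) = fun y => g y * y i := rfl
    have h5 : fderiv ℝ (fun y : EuclideanSpace ℝ (Fin n) => g y * y i) x = _ := h3.fderiv
    rw [h4, h5]
    simp [← fderiv_single_eq_gradient]
    ring
  simp only [divg, h1, Finset.sum_add_distrib, PiLp.inner_apply]
  simp [mul_comm]

theorem two_mul_regWeight_le_divg (hε : 0 < ε) (hn : 2 ≤ n) {b : ℝ} (hb : (n : ℝ) = 2 - 2 * b)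
    (x : EuclideanSpace ℝ (Fin n)) :
    2 * regWeight ε b x ≤ divg (fun y => regWeight ε b y • y) x := by
  rw [divg_smul_id ((contDiff_regWeight hε b).differentiable one_ne_zero x),
    gradient_regWeight hε, real_inner_smul_left, real_inner_self_eq_norm_sq, hb]
  have hb0 : b ≤ 0 := by
    have : (2 : ℝ) ≤ n := by exact_mod_cast hn
    linarith
  nlinarith [norm_sq_mul_regWeight_sub_one_le hε b x]

/-- The Hardy inequality for the regularised weight. -/
theorem integral_sq_mul_regWeight_le (hε : 0 < ε) (hn : 2 ≤ n) {b : ℝ}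
    (hb : (n : ℝ) = 2 - 2 * b) {v : EuclideanSpace ℝ (Fin n) → ℝ} (hv : ContDiff ℝ 1 v)
    (hvc : HasCompactSupport v) :
    ∫ x, v x ^ 2 * regWeight ε b x ≤ ∫ x, ‖x‖ ^ 2 * ‖gradient v x‖ ^ 2 * regWeight ε b x := by
  have cs := (contDiff_regWeight (n := n) hε b).continuous
  have cv := hv.continuous
  have cgv := continuous_gradient hv
  have hz : ∀ x ∉ tsupport v, v x = 0 ∧ gradient v x = 0 := fun x hx =>
    ⟨image_eq_zero_of_notMem_tsupport hx, gradient_eq_zero_of_notMem_tsupport hx⟩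
  have int : ∀ {F : EuclideanSpace ℝ (Fin n) → ℝ}, Continuous F → (∀ x ∉ tsupport v, F x = 0) →
      Integrable F := fun hF h0 => integrable_of_eq_zero_of_notMem_tsupport hF hvc h0
  have hX : ContDiff ℝ 1 fun y : EuclideanSpace ℝ (Fin n) => regWeight ε b y • y :=
    (contDiff_regWeight hε b).smul contDiff_id
  have cX : Continuous (divg fun y : EuclideanSpace ℝ (Fin n) => regWeight ε b y • y) :=
    continuous_divg hX
  have hibp := integral_mul_divg (hv.pow 2) (HasCompactSupport.intro hvc.isCompact
    fun x hx => by simp [hz x hx]) hX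
  have e : ∀ x, inner ℝ (gradient (fun y => v y ^ 2) x) (regWeight ε b x • x) =
      2 * v x * inner ℝ (gradient v x) x * regWeight ε b x := fun x => by
    rw [gradient_fun_pow (hv.differentiable one_ne_zero x)]
    simp only [real_inner_smul_left, real_inner_smul_right]
    push_cast
    ring
  simp only [e, ← integral_neg] at hibp
  have i1 : Integrable fun x => v x ^ 2 * regWeight ε b x :=
    int (by fun_prop) fun x hx => by simp [hz x hx]
  have i2 : Integrable fun x => ‖x‖ ^ 2 * ‖gradient v x‖ ^ 2 * regWeight ε b x :=
    int (by fun_prop) fun x hx => by simp [hz x hx]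
  have h1 : ∫ x, 2 * (v x ^ 2 * regWeight ε b x) ≤
      ∫ x, v x ^ 2 * divg (fun y => regWeight ε b y • y) x := by
    refine integral_mono (i1.const_mul 2) (int (by fun_prop) fun x hx => by simp [hz x hx])
      fun x => ?_
    have := mul_le_mul_of_nonneg_left (two_mul_regWeight_le_divg hε hn hb x) (sq_nonneg (v x))
    linarith
  have h2 : ∫ x, -(2 * v x * inner ℝ (gradient v x) x * regWeight ε b x) ≤
      ∫ x, (v x ^ 2 * regWeight ε b x + ‖x‖ ^ 2 * ‖gradient v x‖ ^ 2 * regWeight ε b x) := by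
    refine integral_mono (int (by fun_prop) fun x hx => by simp [hz x hx]) (i1.add i2)
      fun x => ?_
    have h4 := regWeight_pos hε b x
    have h6 : -(2 * v x * inner ℝ (gradient v x) x) ≤ v x ^ 2 + ‖x‖ ^ 2 * ‖gradient v x‖ ^ 2 := by
      have h7 : |v x * inner ℝ (gradient v x) x| ≤ |v x| * (‖gradient v x‖ * ‖x‖) := by
        rw [abs_mul]
        exact mul_le_mul_of_nonneg_left (abs_real_inner_le_norm _ _) (abs_nonneg _)
      have h8 := neg_abs_le (v x * inner ℝ (gradient v x) x)
      have h9 := sq_nonneg (|v x| - ‖gradient v x‖ * ‖x‖)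
      rw [sub_sq, sq_abs, mul_pow] at h9
      linarith
    have := mul_le_mul_of_nonneg_right h6 h4.le
    linarith
  rw [integral_add i1 i2] at h2
  rw [integral_const_mul] at h1
  linarith

end RegWeight

section WeightedEstimate

variable {n : ℕ} {θ K L ε p δ κ : ℝ}

theorem norm_add_sq_le_of_pos {E : Type*} [SeminormedAddCommGroup E] (x y : E) (hδ : 0 < δ) :
    ‖x + y‖ ^ 2 ≤ (1 + δ) * ‖x‖ ^ 2 + (1 + 1 / δ) * ‖y‖ ^ 2 := by
  have h1 : ‖x + y‖ ^ 2 ≤ (‖x‖ + ‖y‖) ^ 2 := by gcongr; exact norm_add_le x y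
  have h2 : (1 + δ) * ‖x‖ ^ 2 + (1 + 1 / δ) * ‖y‖ ^ 2 - (‖x‖ + ‖y‖) ^ 2 =
      (δ * ‖x‖ - ‖y‖) ^ 2 / δ := by
    field_simp
    ring
  have h3 : 0 ≤ (δ * ‖x‖ - ‖y‖) ^ 2 / δ := by positivity
  linarith

/-- A cutoff function supported in the ball of radius `1/2` and locally constant in the ball of
radius `1/4`, with squared slope at most `L`. -/
structure CentralCutoff (L : ℝ) (φ : EuclideanSpace ℝ (Fin n) → ℝ) : Prop where
  contDiff : ContDiff ℝ 1 φ
  hasCompactSupport : HasCompactSupport φ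
  tsupport_subset : tsupport φ ⊆ ball 0 (1 / 2)
  nonneg : ∀ x, 0 ≤ φ x
  le_one : ∀ x, φ x ≤ 1
  gradient_eq_zero : ∀ x ∈ ball 0 (1 / 4), gradient φ x = 0
  norm_gradient_sq_le : ∀ x, ‖gradient φ x‖ ^ 2 ≤ L

/-- The unweighted energy controlled by the interior estimate. -/
noncomputable def localEnergy (u w : EuclideanSpace ℝ (Fin n) → ℝ) : ℝ :=
  ∫ x in ball 0 (1 / 2), ((u x + w x) ^ 2 + ‖gradient u x‖ ^ 2)

variable {u w φ : EuclideanSpace ℝ (Fin n) → ℝ}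

theorem CentralCutoff.integrable (hφ : CentralCutoff L φ) {F : EuclideanSpace ℝ (Fin n) → ℝ}
    (hF : Continuous F) (h0 : ∀ x ∉ tsupport φ, F x = 0) : Integrable F :=
  integrable_of_eq_zero_of_notMem_tsupport hF hφ.hasCompactSupport h0

theorem CentralCutoff.eq_zero (hφ : CentralCutoff L φ) {x : EuclideanSpace ℝ (Fin n)}
    (hx : x ∉ ball (0 : EuclideanSpace ℝ (Fin n)) (1 / 2)) : φ x = 0 ∧ gradient φ x = 0 :=
  have h := fun h => hx (hφ.tsupport_subset h)
  ⟨image_eq_zero_of_notMem_tsupport h, gradient_eq_zero_of_notMem_tsupport h⟩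

theorem CentralCutoff.integral_le_localEnergy (hφ : CentralCutoff L φ) (h : StablePair θ K u w)
    {F : EuclideanSpace ℝ (Fin n) → ℝ} (hF : Continuous F) (h0 : ∀ x ∉ tsupport φ, F x = 0)
    {C : ℝ} (hC : ∀ x ∈ ball 0 (1 / 2), F x ≤ C * ((u x + w x) ^ 2 + ‖gradient u x‖ ^ 2)) :
    ∫ x, F x ≤ C * localEnergy u w := by
  have cu := h.contDiff_left.continuous
  have cw := h.contDiff_right.continuous
  have cgu := continuous_gradient h.contDiff_one_left
  exact integral_le_mul_setIntegral measurableSet_ball (hφ.integrable hF h0)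
    (Continuous.integrableOn_ball (by fun_prop) _ _) hC
    fun x hx => h0 x fun hx' => hx (hφ.tsupport_subset hx')

theorem StablePair.nonneg_of_mem_ball_half (h : StablePair θ K u w)
    {x : EuclideanSpace ℝ (Fin n)} (hx : x ∈ ball (0 : EuclideanSpace ℝ (Fin n)) (1 / 2)) :
    0 ≤ u x ∧ 0 ≤ w x :=
  have hx' := ball_subset_ball (by norm_num) hx
  ⟨h.nonneg_left x hx', h.nonneg_right x hx'⟩

theorem CentralCutoff.norm_gradient_sq_mul_regWeight_le (hφ : CentralCutoff L φ) (hε : 0 < ε)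
    (hε1 : ε ≤ 1) {a : ℝ} (ha : |a| ≤ 1) (x : EuclideanSpace ℝ (Fin n)) :
    ‖gradient φ x‖ ^ 2 * regWeight ε a x ≤ 16 * L := by
  have hL := (sq_nonneg _).trans (hφ.norm_gradient_sq_le x)
  by_cases h4 : x ∈ ball (0 : EuclideanSpace ℝ (Fin n)) (1 / 4)
  · simpa [hφ.gradient_eq_zero x h4] using hL
  by_cases h2 : x ∈ ball (0 : EuclideanSpace ℝ (Fin n)) (1 / 2)
  · rw [mem_ball_zero_iff] at h4 h2
    have h1 := regWeight_le_sixteen hε hε1 ha (not_lt.1 h4) (by linarith)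
    calc ‖gradient φ x‖ ^ 2 * regWeight ε a x ≤ L * 16 :=
          mul_le_mul (hφ.norm_gradient_sq_le x) h1 (regWeight_pos hε a x).le hL
      _ = _ := mul_comm _ _
  · simpa [(hφ.eq_zero h2).2] using hL

theorem CentralCutoff.integral_sq_mul_gradient_le (hφ : CentralCutoff L φ)
    (h : StablePair θ K u w) (hε : 0 < ε) (hε1 : ε ≤ 1) {a : ℝ} (ha : |a| ≤ 1) :
    ∫ x, w x ^ 2 * (‖gradient φ x‖ ^ 2 * regWeight ε a x) ≤ 16 * L * localEnergy u w := by
  have cw := h.contDiff_right.continuous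
  have cs := (contDiff_regWeight (n := n) hε a).continuous
  have cgφ := continuous_gradient hφ.contDiff
  refine hφ.integral_le_localEnergy h (by fun_prop)
    (fun x hx => by simp [gradient_eq_zero_of_notMem_tsupport hx]) fun x hx => ?_
  obtain ⟨h1, h2⟩ := h.nonneg_of_mem_ball_half hx
  rw [mul_comm (16 * L)]
  refine mul_le_mul ?_ (hφ.norm_gradient_sq_mul_regWeight_le hε hε1 ha x)
    (mul_nonneg (sq_nonneg _) (regWeight_pos hε a x).le) (by positivity)
  nlinarith [sq_nonneg ‖gradient u x‖]

theorem CentralCutoff.integral_stab_le (hφ : CentralCutoff L φ) (h : StablePair θ K u w)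
    (hε : 0 < ε) (hε1 : ε ≤ 1) (hp : |p| ≤ 1) (hδ : 0 < δ) :
    (1 + θ) * ∫ x, ‖gradient w x‖ ^ 2 * φ x ^ 2 * regWeight ε (-p) x ≤
      (1 + δ) * (∫ x, w x ^ 2 * φ x ^ 2 * regWeight ε (-p - 1) x) +
      (1 + 1 / δ) * (16 * L * localEnergy u w) +
      K * ∫ x, ‖gradient u x‖ ^ 2 * φ x ^ 2 * regWeight ε (-p) x := by
  have cw := h.contDiff_right.continuous
  have cφ := hφ.contDiff.continuous
  have cgφ := continuous_gradient hφ.contDiff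
  have hs := contDiff_regWeight (n := n) hε (-p / 2)
  have cs := hs.continuous
  have cs1 := (contDiff_regWeight (n := n) hε (-p)).continuous
  have cs2 := (contDiff_regWeight (n := n) hε (-p - 1)).continuous
  have hη : ContDiff ℝ 1 fun x => φ x * regWeight ε (-p / 2) x := hφ.contDiff.mul hs
  have cgη := continuous_gradient hη
  have hηt : tsupport (fun x => φ x * regWeight ε (-p / 2) x) ⊆ tsupport φ :=
    closure_mono fun x hx hx0 => hx (by simp [hx0])
  have hz : ∀ x ∉ tsupport φ, φ x = 0 ∧ gradient φ x = 0 := fun x hx =>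
    ⟨image_eq_zero_of_notMem_tsupport hx, gradient_eq_zero_of_notMem_tsupport hx⟩
  have hst := h.stab _ hη
    (hφ.hasCompactSupport.isCompact.of_isClosed_subset (isClosed_tsupport _) hηt)
    (hηt.trans (hφ.tsupport_subset.trans (ball_subset_ball (by norm_num))))
  have hsq : ∀ x : EuclideanSpace ℝ (Fin n),
      regWeight ε (-p / 2) x ^ 2 = regWeight ε (-p) x := fun x => by
    rw [sq, regWeight_mul_regWeight hε]
    ring_nf
  simp only [mul_pow, hsq, ← mul_assoc] at hst
  have hgr : ∀ x, ‖gradient (fun y => φ y * regWeight ε (-p / 2) y) x‖ ^ 2 ≤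
      (1 + δ) * (φ x ^ 2 * regWeight ε (-p - 1) x) +
        (1 + 1 / δ) * (‖gradient φ x‖ ^ 2 * regWeight ε (-p) x) := fun x => by
    rw [gradient_fun_mul (hφ.contDiff.differentiable one_ne_zero x)
      (hs.differentiable one_ne_zero x), gradient_regWeight hε, smul_smul]
    refine (norm_add_sq_le_of_pos _ _ hδ).trans ?_
    simp only [norm_smul, mul_pow, Real.norm_eq_abs, sq_abs]
    have h1 : regWeight ε (-p / 2 - 1) x ^ 2 = regWeight ε (-p - 1 - 1) x := by
      rw [sq, regWeight_mul_regWeight hε]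
      ring_nf
    rw [h1, hsq, mul_comm (regWeight ε (-p) x)]
    refine add_le_add (mul_le_mul_of_nonneg_left ?_ (by positivity)) le_rfl
    have h2 : p ^ 2 ≤ 1 := by rwa [sq_le_one_iff_abs_le_one]
    have h3 := norm_sq_mul_regWeight_sub_one_le hε (-p - 1) x
    have h4 := regWeight_pos hε (-p - 1 - 1) x
    calc φ x ^ 2 * (2 ^ 2 * (-p / 2) ^ 2 * regWeight ε (-p - 1 - 1) x) * ‖x‖ ^ 2
        = p ^ 2 * (φ x ^ 2 * (‖x‖ ^ 2 * regWeight ε (-p - 1 - 1) x)) := by ring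
      _ ≤ 1 * (φ x ^ 2 * (‖x‖ ^ 2 * regWeight ε (-p - 1 - 1) x)) := by gcongr
      _ ≤ _ := by rw [one_mul]; gcongr
  have hE := hφ.integral_sq_mul_gradient_le h hε hε1 (a := -p) (by rwa [abs_neg])
  have i1 : Integrable fun x => w x ^ 2 * φ x ^ 2 * regWeight ε (-p - 1) x :=
    hφ.integrable (by fun_prop) fun x hx => by simp [hz x hx]
  have i2 : Integrable fun x => w x ^ 2 * (‖gradient φ x‖ ^ 2 * regWeight ε (-p) x) :=
    hφ.integrable (by fun_prop) fun x hx => by simp [hz x hx]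
  have hmono : ∫ x, w x ^ 2 * ‖gradient (fun y => φ y * regWeight ε (-p / 2) y) x‖ ^ 2 ≤
      ∫ x, ((1 + δ) * (w x ^ 2 * φ x ^ 2 * regWeight ε (-p - 1) x) +
        (1 + 1 / δ) * (w x ^ 2 * (‖gradient φ x‖ ^ 2 * regWeight ε (-p) x))) := by
    refine integral_mono (hφ.integrable (by fun_prop) fun x hx => ?_)
      ((i1.const_mul _).add (i2.const_mul _)) fun x => ?_
    · rw [gradient_eq_zero_of_notMem_tsupport fun h => hx (hηt h)]
      simp
    · have := mul_le_mul_of_nonneg_left (hgr x) (sq_nonneg (w x))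
      linarith
  rw [integral_add (i1.const_mul _) (i2.const_mul _), integral_const_mul,
    integral_const_mul] at hmono
  have := mul_le_mul_of_nonneg_left hE (by positivity : 0 ≤ 1 + 1 / δ)
  linarith

theorem CentralCutoff.integral_hardy_le (hφ : CentralCutoff L φ) (h : StablePair θ K u w)
    (hε : 0 < ε) (hε1 : ε ≤ 1) (hp : |p| ≤ 1) (hn : (n : ℝ) = 2 * p + 4) (hδ : 0 < δ) :
    ∫ x, w x ^ 2 * φ x ^ 2 * regWeight ε (-p - 1) x ≤
      (1 + δ) * (∫ x, ‖gradient w x‖ ^ 2 * φ x ^ 2 * regWeight ε (-p) x) +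
      (1 + 1 / δ) * (16 * L * localEnergy u w) := by
  have hw1 := h.contDiff_one_right
  have cw := hw1.continuous
  have cgw := continuous_gradient hw1
  have cφ := hφ.contDiff.continuous
  have cgφ := continuous_gradient hφ.contDiff
  have cs1 := (contDiff_regWeight (n := n) hε (-p)).continuous
  have cs2 := (contDiff_regWeight (n := n) hε (-p - 1)).continuous
  have hv : ContDiff ℝ 1 fun x => φ x * w x := hφ.contDiff.mul hw1
  have cgv := continuous_gradient hv
  have hvt : tsupport (fun x => φ x * w x) ⊆ tsupport φ :=
    closure_mono fun x hx hx0 => hx (by simp [hx0])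
  have hz : ∀ x ∉ tsupport φ, φ x = 0 ∧ gradient φ x = 0 := fun x hx =>
    ⟨image_eq_zero_of_notMem_tsupport hx, gradient_eq_zero_of_notMem_tsupport hx⟩
  have hn2 : 2 ≤ n := by
    have : (2 : ℝ) ≤ n := by linarith [(abs_le.1 hp).1]
    exact_mod_cast this
  have hH := integral_sq_mul_regWeight_le hε hn2 (b := -p - 1) (by linarith) hv
    (hφ.hasCompactSupport.isCompact.of_isClosed_subset (isClosed_tsupport _) hvt)
  have hE := hφ.integral_sq_mul_gradient_le h hε hε1 (a := -p) (by rwa [abs_neg])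
  have i1 : Integrable fun x => ‖gradient w x‖ ^ 2 * φ x ^ 2 * regWeight ε (-p) x :=
    hφ.integrable (by fun_prop) fun x hx => by simp [hz x hx]
  have i2 : Integrable fun x => w x ^ 2 * (‖gradient φ x‖ ^ 2 * regWeight ε (-p) x) :=
    hφ.integrable (by fun_prop) fun x hx => by simp [hz x hx]
  have hmono : ∫ x, ‖x‖ ^ 2 * ‖gradient (fun y => φ y * w y) x‖ ^ 2 * regWeight ε (-p - 1) x ≤
      ∫ x, ((1 + δ) * (‖gradient w x‖ ^ 2 * φ x ^ 2 * regWeight ε (-p) x) +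
        (1 + 1 / δ) * (w x ^ 2 * (‖gradient φ x‖ ^ 2 * regWeight ε (-p) x))) := by
    refine integral_mono (hφ.integrable (by fun_prop) fun x hx => ?_)
      ((i1.const_mul _).add (i2.const_mul _)) fun x => ?_
    · rw [gradient_eq_zero_of_notMem_tsupport fun h => hx (hvt h)]
      simp
    · have h1 := norm_add_sq_le_of_pos (φ x • gradient w x) (w x • gradient φ x) hδ
      simp only [norm_smul, mul_pow, Real.norm_eq_abs, sq_abs] at h1
      simp only
      rw [gradient_fun_mul (hφ.contDiff.differentiable one_ne_zero x)
        (hw1.differentiable one_ne_zero x)]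
      have h2 := norm_sq_mul_regWeight_sub_one_le hε (-p) x
      have h3 := regWeight_pos hε (-p) x
      calc ‖x‖ ^ 2 * ‖φ x • gradient w x + w x • gradient φ x‖ ^ 2 * regWeight ε (-p - 1) x
          = ‖φ x • gradient w x + w x • gradient φ x‖ ^ 2 *
            (‖x‖ ^ 2 * regWeight ε (-p - 1) x) := by ring
        _ ≤ ‖φ x • gradient w x + w x • gradient φ x‖ ^ 2 * regWeight ε (-p) x := by gcongr
        _ ≤ ((1 + δ) * (φ x ^ 2 * ‖gradient w x‖ ^ 2) +
            (1 + 1 / δ) * (w x ^ 2 * ‖gradient φ x‖ ^ 2)) * regWeight ε (-p) x := by gcongr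
        _ = _ := by ring
  rw [integral_add (i1.const_mul _) (i2.const_mul _), integral_const_mul,
    integral_const_mul] at hmono
  have := mul_le_mul_of_nonneg_left hE (by positivity : 0 ≤ 1 + 1 / δ)
  simp only [mul_pow, mul_comm (φ _ ^ 2) (w _ ^ 2)] at hH
  linarith

end WeightedEstimate

section WeightedEstimate

variable {n : ℕ} {θ K L ε p κ : ℝ} {u w φ : EuclideanSpace ℝ (Fin n) → ℝ}

theorem CentralCutoff.integral_radial_gradient_le (hφ : CentralCutoff L φ)
    (h : StablePair θ K u w) (hε : 0 < ε) (hε1 : ε ≤ 1) (hp0 : 0 ≤ p) (hp1 : p ≤ 1)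
    (hn : (n : ℝ) = 2 * p + 4) :
    2 * ∫ x, u x * φ x ^ 2 * regWeight ε (-p - 1) x * inner ℝ x (gradient u x) ≤
      256 * (1 + L) * localEnergy u w := by
  have hu1 := h.contDiff_one_left
  have cu := hu1.continuous
  have cgu := continuous_gradient hu1
  have cφ := hφ.contDiff.continuous
  have cgφ := continuous_gradient hφ.contDiff
  have hs := contDiff_regWeight (n := n) hε (-p - 1)
  have cs := hs.continuous
  have hz : ∀ x ∉ tsupport φ, φ x = 0 ∧ gradient φ x = 0 := fun x hx =>
    ⟨image_eq_zero_of_notMem_tsupport hx, gradient_eq_zero_of_notMem_tsupport hx⟩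
  have hn2 : 2 ≤ n := by
    have : (2 : ℝ) ≤ n := by linarith
    exact_mod_cast this
  have hg : ContDiff ℝ 1 fun x => u x ^ 2 * φ x ^ 2 := (hu1.pow 2).mul (hφ.contDiff.pow 2)
  have hX : ContDiff ℝ 1 fun y : EuclideanSpace ℝ (Fin n) => regWeight ε (-p - 1) y • y :=
    hs.smul contDiff_id
  have hibp := integral_mul_divg hg (HasCompactSupport.intro hφ.hasCompactSupport.isCompact
    fun x hx => by simp [hz x hx]) hX
  have e : ∀ x, inner ℝ (gradient (fun y => u y ^ 2 * φ y ^ 2) x)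
      (regWeight ε (-p - 1) x • x) =
      2 * (u x * φ x ^ 2 * regWeight ε (-p - 1) x * inner ℝ x (gradient u x)) +
        2 * (u x ^ 2 * φ x * regWeight ε (-p - 1) x * inner ℝ (gradient φ x) x) := fun x => by
    have d1 := hu1.differentiable one_ne_zero x
    have d2 := hφ.contDiff.differentiable one_ne_zero x
    have d3 : DifferentiableAt ℝ (fun y => u y ^ 2) x := d1.pow 2
    have d4 : DifferentiableAt ℝ (fun y => φ y ^ 2) x := d2.pow 2
    rw [gradient_fun_mul d3 d4, gradient_fun_pow d1, gradient_fun_pow d2,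
      ← real_inner_comm x (gradient u x)]
    simp only [inner_add_left, real_inner_smul_left, real_inner_smul_right]
    push_cast
    ring
  have i1 : Integrable fun x =>
      u x * φ x ^ 2 * regWeight ε (-p - 1) x * inner ℝ x (gradient u x) :=
    hφ.integrable (by fun_prop) fun x hx => by simp [hz x hx]
  have i2 : Integrable fun x =>
      u x ^ 2 * φ x * regWeight ε (-p - 1) x * inner ℝ (gradient φ x) x :=
    hφ.integrable (by fun_prop) fun x hx => by simp [hz x hx]
  simp only [e] at hibp
  rw [integral_add (i1.const_mul _) (i2.const_mul _), integral_const_mul,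
    integral_const_mul] at hibp
  have hnonneg : 0 ≤ ∫ x, u x ^ 2 * φ x ^ 2 * divg (fun y => regWeight ε (-p - 1) y • y) x :=
    integral_nonneg fun x => mul_nonneg (by positivity)
      ((mul_pos two_pos (regWeight_pos hε _ x)).le.trans
        (two_mul_regWeight_le_divg hε hn2 (by linarith) x))
  have hbd : ∫ x, -2 * (u x ^ 2 * φ x * regWeight ε (-p - 1) x * inner ℝ (gradient φ x) x) ≤
      256 * (1 + L) * localEnergy u w := by
    refine hφ.integral_le_localEnergy h (by fun_prop) (fun x hx => by simp [hz x hx])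
      fun x hx => ?_
    have hL := (sq_nonneg _).trans (hφ.norm_gradient_sq_le x)
    by_cases h4 : x ∈ ball (0 : EuclideanSpace ℝ (Fin n)) (1 / 4)
    · rw [hφ.gradient_eq_zero x h4]
      simp only [inner_zero_left, mul_zero]
      positivity
    obtain ⟨h1, h2⟩ := h.nonneg_of_mem_ball_half hx
    rw [mem_ball_zero_iff] at h4 hx
    have h5 : regWeight ε (-p - 1) x ≤ 256 := by
      rw [sub_eq_add_neg, ← regWeight_mul_regWeight hε]
      have h6 := regWeight_le_sixteen (a := -p) hε hε1 (by rw [abs_le]; constructor <;> linarith)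
        (not_lt.1 h4) (by linarith)
      have h7 := regWeight_le_sixteen (a := -1) hε hε1 (by norm_num)
        (not_lt.1 h4) (by linarith)
      have h8 := regWeight_pos hε (-p) x
      have h9 := regWeight_pos hε (-1) x
      nlinarith
    have h6 : |inner ℝ (gradient φ x) x| ≤ ‖gradient φ x‖ :=
      (abs_real_inner_le_norm _ _).trans
        (mul_le_of_le_one_right (norm_nonneg _) (by linarith))
    have h7 : 2 * ‖gradient φ x‖ ≤ 1 + L := by
      nlinarith [hφ.norm_gradient_sq_le x, sq_nonneg (‖gradient φ x‖ - 1)]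
    have h8 := regWeight_pos hε (-p - 1) x
    have h9 : φ x * (2 * |inner ℝ (gradient φ x) x|) ≤ 1 + L := by
      have := mul_le_of_le_one_left (abs_nonneg (inner ℝ (gradient φ x) x)) (hφ.le_one x)
      linarith
    have h10 := hφ.nonneg x
    calc -2 * (u x ^ 2 * φ x * regWeight ε (-p - 1) x * inner ℝ (gradient φ x) x)
        = u x ^ 2 * (regWeight ε (-p - 1) x * (φ x * (2 * -inner ℝ (gradient φ x) x))) := by
          ring
      _ ≤ u x ^ 2 * (regWeight ε (-p - 1) x * (φ x * (2 * |inner ℝ (gradient φ x) x|))) := by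
          gcongr
          exact neg_le_abs _
      _ ≤ ((u x + w x) ^ 2 + ‖gradient u x‖ ^ 2) * (256 * (1 + L)) := by
          gcongr
          nlinarith [sq_nonneg ‖gradient u x‖]
      _ = _ := mul_comm _ _
  rw [integral_const_mul] at hbd
  linarith

theorem CentralCutoff.integral_cross_gradient_le (hφ : CentralCutoff L φ)
    (h : StablePair θ K u w) (hε : 0 < ε) (hε1 : ε ≤ 1) (hp : |p| ≤ 1) :
    -(2 * ∫ x, u x * φ x * regWeight ε (-p) x * inner ℝ (gradient φ x) (gradient u x)) ≤
      16 * (1 + L) * localEnergy u w := by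
  have hu1 := h.contDiff_one_left
  have cu := hu1.continuous
  have cgu := continuous_gradient hu1
  have cφ := hφ.contDiff.continuous
  have cgφ := continuous_gradient hφ.contDiff
  have cs := (contDiff_regWeight (n := n) hε (-p)).continuous
  rw [← neg_mul, ← integral_const_mul]
  refine hφ.integral_le_localEnergy h (by fun_prop)
    (fun x hx => by simp [image_eq_zero_of_notMem_tsupport hx]) fun x hx => ?_
  have hL := (sq_nonneg _).trans (hφ.norm_gradient_sq_le x)
  by_cases h4 : x ∈ ball (0 : EuclideanSpace ℝ (Fin n)) (1 / 4)
  · rw [hφ.gradient_eq_zero x h4]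
    simp only [inner_zero_left, mul_zero]
    positivity
  obtain ⟨h1, h2⟩ := h.nonneg_of_mem_ball_half hx
  rw [mem_ball_zero_iff] at h4 hx
  have h5 := regWeight_le_sixteen (a := -p) hε hε1 (by rwa [abs_neg])
    (not_lt.1 h4) (by linarith)
  have h6 := regWeight_pos hε (-p) x
  have h7 := hφ.nonneg x
  have h8 : 2 * (u x * φ x * |inner ℝ (gradient φ x) (gradient u x)|) ≤
      (1 + L) * ((u x + w x) ^ 2 + ‖gradient u x‖ ^ 2) := by
    have h9 : u x * φ x * |inner ℝ (gradient φ x) (gradient u x)| ≤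
        u x * 1 * (‖gradient φ x‖ * ‖gradient u x‖) := by
      gcongr
      · exact hφ.le_one x
      · exact abs_real_inner_le_norm _ _
    have h10 := sq_nonneg (u x - ‖gradient φ x‖ * ‖gradient u x‖)
    have h11 := mul_le_mul_of_nonneg_right (hφ.norm_gradient_sq_le x)
      (sq_nonneg ‖gradient u x‖)
    have h12 : u x ^ 2 ≤ (u x + w x) ^ 2 := by gcongr; linarith
    have h13 := mul_nonneg hL (sq_nonneg (u x + w x))
    nlinarith [sq_nonneg ‖gradient u x‖]
  calc -2 * (u x * φ x * regWeight ε (-p) x * inner ℝ (gradient φ x) (gradient u x))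
      = regWeight ε (-p) x * (2 * (u x * φ x * -inner ℝ (gradient φ x) (gradient u x))) := by
        ring
    _ ≤ regWeight ε (-p) x * (2 * (u x * φ x * |inner ℝ (gradient φ x) (gradient u x)|)) := by
        gcongr
        exact neg_le_abs _
    _ ≤ 16 * ((1 + L) * ((u x + w x) ^ 2 + ‖gradient u x‖ ^ 2)) := by gcongr
    _ = _ := by ring

theorem CentralCutoff.integral_gradient_left_le_of_nonneg (hφ : CentralCutoff L φ)
    (h : StablePair θ K u w) (hε : 0 < ε) (hε1 : ε ≤ 1) (hp0 : 0 ≤ p) (hp1 : p ≤ 1)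
    (hn : (n : ℝ) = 2 * p + 4) (hκ : 0 < κ) :
    ∫ x, ‖gradient u x‖ ^ 2 * φ x ^ 2 * regWeight ε (-p) x ≤
      κ * (∫ x, w x ^ 2 * φ x ^ 2 * regWeight ε (-p - 1) x) +
        (1 / κ + 272 * (1 + L)) * localEnergy u w := by
  have hu1 := h.contDiff_one_left
  have cu := hu1.continuous
  have cw := h.contDiff_right.continuous
  have cgu := continuous_gradient hu1
  have cφ := hφ.contDiff.continuous
  have cgφ := continuous_gradient hφ.contDiff
  have hs := contDiff_regWeight (n := n) hε (-p)
  have cs := hs.continuous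
  have cs1 := (contDiff_regWeight (n := n) hε (-p - 1)).continuous
  have hz : ∀ x ∉ tsupport φ, φ x = 0 ∧ gradient φ x = 0 := fun x hx =>
    ⟨image_eq_zero_of_notMem_tsupport hx, gradient_eq_zero_of_notMem_tsupport hx⟩
  have hh : ContDiff ℝ 1 fun x => φ x ^ 2 * regWeight ε (-p) x := (hφ.contDiff.pow 2).mul hs
  have hg : ContDiff ℝ 1 fun x => u x * (φ x ^ 2 * regWeight ε (-p) x) := hu1.mul hh
  have hibp := integral_mul_lap hg (HasCompactSupport.intro hφ.hasCompactSupport.isCompact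
    fun x hx => by simp [hz x hx]) h.contDiff_left
  have e1 : ∀ x, u x * (φ x ^ 2 * regWeight ε (-p) x) * lap u x =
      -(u x * w x * φ x ^ 2 * regWeight ε (-p) x) := fun x => by
    by_cases hx : x ∈ tsupport φ
    · rw [h.lap_eq x (ball_subset_ball (by norm_num) (hφ.tsupport_subset hx))]
      ring
    · simp [hz x hx]
  have e2 : ∀ x, inner ℝ (gradient (fun y => u y * (φ y ^ 2 * regWeight ε (-p) y)) x)
      (gradient u x) = ‖gradient u x‖ ^ 2 * φ x ^ 2 * regWeight ε (-p) x +
        (2 * (u x * φ x * regWeight ε (-p) x * inner ℝ (gradient φ x) (gradient u x)) +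
        -(2 * p) * (u x * φ x ^ 2 * regWeight ε (-p - 1) x * inner ℝ x (gradient u x))) :=
      fun x => by
    have d2 := hφ.contDiff.differentiable one_ne_zero x
    have d4 : DifferentiableAt ℝ (fun y => φ y ^ 2) x := d2.pow 2
    rw [gradient_fun_mul (hu1.differentiable one_ne_zero x) (hh.differentiable one_ne_zero x),
      gradient_fun_mul d4 (hs.differentiable one_ne_zero x), gradient_fun_pow d2,
      gradient_regWeight hε]
    simp only [inner_add_left, real_inner_smul_left, real_inner_self_eq_norm_sq, smul_add,
      smul_smul]
    push_cast
    ring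
  have i1 : Integrable fun x => ‖gradient u x‖ ^ 2 * φ x ^ 2 * regWeight ε (-p) x :=
    hφ.integrable (by fun_prop) fun x hx => by simp [hz x hx]
  have i2 : Integrable fun x =>
      u x * φ x * regWeight ε (-p) x * inner ℝ (gradient φ x) (gradient u x) :=
    hφ.integrable (by fun_prop) fun x hx => by simp [hz x hx]
  have i3 : Integrable fun x =>
      u x * φ x ^ 2 * regWeight ε (-p - 1) x * inner ℝ x (gradient u x) :=
    hφ.integrable (by fun_prop) fun x hx => by simp [hz x hx]
  have i4 : Integrable fun x => u x * w x * φ x ^ 2 * regWeight ε (-p) x :=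
    hφ.integrable (by fun_prop) fun x hx => by simp [hz x hx]
  have i5 : Integrable fun x => w x ^ 2 * φ x ^ 2 * regWeight ε (-p - 1) x :=
    hφ.integrable (by fun_prop) fun x hx => by simp [hz x hx]
  simp only [e1, e2, integral_neg] at hibp
  have i23 : Integrable fun x =>
      2 * (u x * φ x * regWeight ε (-p) x * inner ℝ (gradient φ x) (gradient u x)) +
        -(2 * p) * (u x * φ x ^ 2 * regWeight ε (-p - 1) x * inner ℝ x (gradient u x)) :=
    (i2.const_mul _).add (i3.const_mul _)
  rw [integral_add i1 i23, integral_add (i2.const_mul _) (i3.const_mul _), integral_const_mul,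
    integral_const_mul] at hibp
  have hcross := hφ.integral_cross_gradient_le h hε hε1 (abs_le.2 ⟨by linarith, hp1⟩)
  have hrad := hφ.integral_radial_gradient_le h hε hε1 hp0 hp1 hn
  have hE0 : 0 ≤ localEnergy u w := integral_nonneg fun x => by positivity
  have hL := (sq_nonneg _).trans (hφ.norm_gradient_sq_le 0)
  have hrad' : p * (2 * ∫ x, u x * φ x ^ 2 * regWeight ε (-p - 1) x *
      inner ℝ x (gradient u x)) ≤ 256 * (1 + L) * localEnergy u w :=
    (mul_le_mul_of_nonneg_left hrad hp0).trans (mul_le_of_le_one_left (by positivity) hp1)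
  have huw : ∫ x, (u x * w x * φ x ^ 2 * regWeight ε (-p) x -
      κ * (w x ^ 2 * φ x ^ 2 * regWeight ε (-p - 1) x)) ≤ 1 / κ * localEnergy u w := by
    refine hφ.integral_le_localEnergy h (by fun_prop) (fun x hx => by simp [hz x hx])
      fun x hx => ?_
    obtain ⟨h1, h2⟩ := h.nonneg_of_mem_ball_half hx
    rw [mem_ball_zero_iff] at hx
    have h3 := regWeight_le_two (a := 1 - p) hε hε1 (by linarith) (by linarith)
      (by linarith : ‖x‖ ≤ 1)
    have h4 := regWeight_sub_one_mul hε (-p) x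
    have h5 := regWeight_sub_one_mul hε (1 - p) x
    rw [show 1 - p - 1 = -p by ring] at h5
    have h6 := regWeight_pos hε (-p - 1) x
    set s := ‖x‖ ^ 2 + ε
    set b := regWeight ε (-p - 1) x
    rw [← h4] at h5 ⊢
    have h7 : φ x ^ 2 ≤ 1 := pow_le_one₀ (hφ.nonneg x) (hφ.le_one x)
    have h8 : u x * w x * φ x ^ 2 * (b * s) - κ * (w x ^ 2 * φ x ^ 2 * b) ≤
        φ x ^ 2 * (u x ^ 2 * (b * s * s)) / (4 * κ) := by
      have h9 : φ x ^ 2 * (u x ^ 2 * (b * s * s)) / (4 * κ) -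
          (u x * w x * φ x ^ 2 * (b * s) - κ * (w x ^ 2 * φ x ^ 2 * b)) =
          φ x ^ 2 * b * (u x * s - 2 * κ * w x) ^ 2 / (4 * κ) := by
        field_simp
        ring
      have h10 : 0 ≤ φ x ^ 2 * b * (u x * s - 2 * κ * w x) ^ 2 / (4 * κ) := by positivity
      linarith
    refine h8.trans ?_
    rw [h5]
    have h11 : u x ^ 2 ≤ (u x + w x) ^ 2 + ‖gradient u x‖ ^ 2 := by
      nlinarith [sq_nonneg ‖gradient u x‖]
    have h12 := regWeight_pos hε (1 - p) x
    calc φ x ^ 2 * (u x ^ 2 * regWeight ε (1 - p) x) / (4 * κ)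
        ≤ 1 * (((u x + w x) ^ 2 + ‖gradient u x‖ ^ 2) * 4) / (4 * κ) := by
          gcongr
          linarith
      _ = _ := by field_simp
  rw [integral_sub i4 (i5.const_mul _), integral_const_mul] at huw
  linarith

theorem CentralCutoff.integral_gradient_left_le_of_nonpos (hφ : CentralCutoff L φ)
    (h : StablePair θ K u w) (hε : 0 < ε) (hε1 : ε ≤ 1) (hp0 : p ≤ 0) (hp1 : -1 ≤ p) :
    ∫ x, ‖gradient u x‖ ^ 2 * φ x ^ 2 * regWeight ε (-p) x ≤ 2 * localEnergy u w := by
  have cgu := continuous_gradient h.contDiff_one_left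
  have cφ := hφ.contDiff.continuous
  have cs := (contDiff_regWeight (n := n) hε (-p)).continuous
  refine hφ.integral_le_localEnergy h (by fun_prop)
    (fun x hx => by simp [image_eq_zero_of_notMem_tsupport hx]) fun x hx => ?_
  rw [mem_ball_zero_iff] at hx
  have h3 := regWeight_le_two (a := -p) hε hε1 (by linarith) (by linarith)
    (by linarith : ‖x‖ ≤ 1)
  have h7 : φ x ^ 2 ≤ 1 := pow_le_one₀ (hφ.nonneg x) (hφ.le_one x)
  have h8 := regWeight_pos hε (-p) x
  calc ‖gradient u x‖ ^ 2 * φ x ^ 2 * regWeight ε (-p) x ≤ ‖gradient u x‖ ^ 2 * 1 * 2 := by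
        gcongr
    _ ≤ _ := by nlinarith [sq_nonneg (u x + w x)]

end WeightedEstimate

section WeightedEstimate

variable {n : ℕ}

theorem exists_setIntegral_regWeight_le (n : ℕ) (hn3 : 3 ≤ n) (hn6 : n ≤ 6) (θ K : ℝ)
    (hθ : 0 < θ) (hK : 0 ≤ K) :
    ∃ C : ℝ, 0 < C ∧ ∀ u w : EuclideanSpace ℝ (Fin n) → ℝ, StablePair θ K u w →
      ∀ ε : ℝ, 0 < ε → ε ≤ 1 →
      ∫ x in ball 0 (3 / 16), (w x ^ 2 + ‖x‖ ^ 2 * ‖gradient w x‖ ^ 2) *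
        regWeight ε ((2 - n) / 2) x ≤ C * (∫ x in ball 0 (3 / 4), u x) ^ 2 := by
  let φ : ContDiffBump (0 : EuclideanSpace ℝ (Fin n)) :=
    ⟨1 / 4, 1 / 3, by norm_num, by norm_num⟩
  have hφt : tsupport φ = closedBall 0 (1 / 3) := φ.tsupport_eq
  have hφ1 : ContDiff ℝ 1 φ := φ.contDiff
  have cφ := hφ1.continuous
  obtain ⟨L₀, hL₀⟩ := (hasCompactSupport_gradient
    φ.hasCompactSupport).exists_bound_of_continuous (continuous_gradient hφ1)
  have hφ : CentralCutoff (L₀ ^ 2) φ :=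
    { contDiff := hφ1
      hasCompactSupport := φ.hasCompactSupport
      tsupport_subset := by
        rw [hφt]
        exact closedBall_subset_ball (by norm_num)
      nonneg := fun x => φ.nonneg
      le_one := fun x => φ.le_one
      gradient_eq_zero := fun x hx => by
        have h : φ =ᶠ[𝓝 x] fun _ => (1 : ℝ) :=
          φ.eventuallyEq_one_of_mem_ball hx
        rw [h.gradient_eq, gradient_fun_const]
      norm_gradient_sq_le := fun x => pow_le_pow_left₀ (norm_nonneg _) (hL₀ x) 2 }
  obtain ⟨C₀, hC₀, hE⟩ := exists_setIntegral_ball_half_le n hn3 hn6 θ K hθ hK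
  have hL0 := sq_nonneg L₀
  set L := L₀ ^ 2
  set p : ℝ := (n - 4) / 2 with hp
  have h3 : (3 : ℝ) ≤ n := by exact_mod_cast hn3
  have h6 : (n : ℝ) ≤ 6 := by exact_mod_cast hn6
  have hn : (n : ℝ) = 2 * p + 4 := by rw [hp]; ring
  have hp1 : |p| ≤ 1 := abs_le.2 ⟨by linarith, by linarith⟩
  set δ : ℝ := min 1 (θ / 10)
  have hδ : 0 < δ := lt_min one_pos (by positivity)
  have hδ1 : δ ≤ 1 := min_le_left _ _
  have hδθ : 10 * δ ≤ θ := by linarith [min_le_right 1 (θ / 10)]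
  set κ : ℝ := δ / (K + 1) with hκ_def
  have hκ : 0 < κ := by positivity
  have hKκ : K * κ ≤ δ := by
    rw [hκ_def, mul_div_assoc', div_le_iff₀ (by positivity)]
    nlinarith
  set e := (1 + 1 / δ) * (16 * L)
  set D := 1 / κ + 272 * (1 + L) with hD
  set b := 2 / θ * (4 * e + K * D) with hb
  have he : 0 ≤ e := by positivity
  have hD2 : 2 ≤ D := by
    have : 0 < 1 / κ := by positivity
    linarith
  have hb0 : 0 ≤ b := by positivity
  refine ⟨(3 * b + e + 1) * C₀, by positivity, fun u w h ε hε hε1 => ?_⟩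
  have cw := h.contDiff_right.continuous
  have cgw := continuous_gradient h.contDiff_one_right
  have cs (a : ℝ) := (contDiff_regWeight (n := n) hε a).continuous
  have cs1 := cs (-p)
  have cs2 := cs (-p - 1)
  have hstab := hφ.integral_stab_le h hε hε1 hp1 hδ
  have hhardy := hφ.integral_hardy_le h hε hε1 hp1 hn hδ
  have hEle : localEnergy u w ≤ C₀ * (∫ x in ball 0 (3 / 4), u x) ^ 2 := hE u w h
  have hE0 : 0 ≤ localEnergy u w := integral_nonneg fun x => by positivity
  have hA0 : 0 ≤ ∫ x, w x ^ 2 * φ x ^ 2 * regWeight ε (-p - 1) x :=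
    integral_nonneg fun x => mul_nonneg (by positivity) (regWeight_pos hε _ x).le
  have hB0 : 0 ≤ ∫ x, ‖gradient w x‖ ^ 2 * φ x ^ 2 * regWeight ε (-p) x :=
    integral_nonneg fun x => mul_nonneg (by positivity) (regWeight_pos hε _ x).le
  have hG : ∫ x, ‖gradient u x‖ ^ 2 * φ x ^ 2 * regWeight ε (-p) x ≤
      κ * (∫ x, w x ^ 2 * φ x ^ 2 * regWeight ε (-p - 1) x) + D * localEnergy u w := by
    rcases le_total 0 p with hp0 | hp0
    · exact hφ.integral_gradient_left_le_of_nonneg h hε hε1 hp0 (abs_le.1 hp1).2 hn hκ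
    · refine (hφ.integral_gradient_left_le_of_nonpos h hε hε1 hp0 (abs_le.1 hp1).1).trans ?_
      have := mul_le_mul_of_nonneg_right hD2 hE0
      have := mul_nonneg hκ.le hA0
      linarith
  have hint : ∫ x in ball 0 (3 / 16), (w x ^ 2 + ‖x‖ ^ 2 * ‖gradient w x‖ ^ 2) *
      regWeight ε ((2 - n) / 2) x ≤
      (∫ x, w x ^ 2 * φ x ^ 2 * regWeight ε (-p - 1) x) +
        ∫ x, ‖gradient w x‖ ^ 2 * φ x ^ 2 * regWeight ε (-p) x := by
    have i1 : Integrable fun x => w x ^ 2 * φ x ^ 2 * regWeight ε (-p - 1) x :=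
      hφ.integrable (by fun_prop) fun x hx => by simp [image_eq_zero_of_notMem_tsupport hx]
    have i2 : Integrable fun x => ‖gradient w x‖ ^ 2 * φ x ^ 2 * regWeight ε (-p) x :=
      hφ.integrable (by fun_prop) fun x hx => by simp [image_eq_zero_of_notMem_tsupport hx]
    rw [← integral_add i1 i2, show ((2 : ℝ) - n) / 2 = -p - 1 by linarith]
    refine setIntegral_le_integral_of_le measurableSet_ball
      (Continuous.integrableOn_ball (by fun_prop) _ _) (i1.add i2) (fun x hx => ?_) fun x => ?_
    · rw [φ.one_of_mem_closedBall (ball_subset_closedBall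
        (ball_subset_ball (by norm_num : (3 : ℝ) / 16 ≤ 1 / 4) hx))]
      have := mul_le_mul_of_nonneg_left (norm_sq_mul_regWeight_sub_one_le hε (-p) x)
        (sq_nonneg ‖gradient w x‖)
      linarith
    · have := regWeight_pos hε (-p) x
      have := regWeight_pos hε (-p - 1) x
      positivity
  set A := ∫ x, w x ^ 2 * φ x ^ 2 * regWeight ε (-p - 1) x
  set B := ∫ x, ‖gradient w x‖ ^ 2 * φ x ^ 2 * regWeight ε (-p) x
  set E := localEnergy u w
  have hBle : B ≤ b * E := by
    have h1 := mul_le_mul_of_nonneg_left hG hK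
    have h2 := mul_le_mul_of_nonneg_right hKκ hA0
    have h4 : A ≤ (1 + δ) * B + e * E := by linarith
    have h5 := mul_le_mul_of_nonneg_left h4 (by positivity : 0 ≤ 1 + 2 * δ)
    have h7 : (1 + 2 * δ) * (1 + δ) ≤ 1 + θ / 2 := by nlinarith
    have h8 := mul_le_mul_of_nonneg_right h7 hB0
    have h9 : (1 + 2 * δ) * (e * E) ≤ 3 * (e * E) :=
      mul_le_mul_of_nonneg_right (by linarith) (by positivity)
    have h10 : θ / 2 * B ≤ (4 * e + K * D) * E := by linarith
    have h11 := mul_le_mul_of_nonneg_left h10 (by positivity : 0 ≤ 2 / θ)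
    have h12 : 2 / θ * (θ / 2 * B) = B := by field_simp
    linarith
  have hAle : A ≤ 2 * B + e * E := by
    have := mul_le_mul_of_nonneg_right hδ1 hB0
    linarith
  calc _ ≤ A + B := hint
    _ ≤ (3 * b + e + 1) * E := by linarith
    _ ≤ (3 * b + e + 1) * (C₀ * (∫ x in ball 0 (3 / 4), u x) ^ 2) := by gcongr
    _ = _ := by ring

theorem tendsto_regWeight {a : ℝ} {x : EuclideanSpace ℝ (Fin n)} (hx : x ≠ 0) :
    Tendsto (fun ε => regWeight ε (a / 2) x) (𝓝 0) (𝓝 (‖x‖ ^ a)) := by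
  have hx0 : ‖x‖ ^ 2 + 0 ≠ 0 := by simpa using hx
  have h1 : ‖x‖ ^ a = (‖x‖ ^ 2 + 0) ^ (a / 2) := by
    rw [add_zero, ← Real.rpow_natCast, ← Real.rpow_mul (norm_nonneg x)]
    congr 1
    push_cast
    ring
  rw [h1]
  exact (tendsto_const_nhds.add tendsto_id).rpow_const (Or.inl hx0)

theorem regWeight_le_rpow_norm {a ε : ℝ} (ha : a ≤ 0) (hε : 0 < ε)
    {x : EuclideanSpace ℝ (Fin n)} (hx : x ≠ 0) : regWeight ε (a / 2) x ≤ ‖x‖ ^ a := by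
  have hx0 : 0 < ‖x‖ ^ 2 := by positivity
  calc regWeight ε (a / 2) x ≤ (‖x‖ ^ 2) ^ (a / 2) :=
        Real.rpow_le_rpow_of_nonpos hx0 (by linarith) (by linarith)
    _ = ‖x‖ ^ a := by
        rw [← Real.rpow_natCast, ← Real.rpow_mul (norm_nonneg x)]
        congr 1
        push_cast
        ring

theorem setIntegral_mul_rpow_norm_le [Nonempty (Fin n)] {s : Set (EuclideanSpace ℝ (Fin n))}
    {g : EuclideanSpace ℝ (Fin n) → ℝ} (hg : Continuous g) (hg0 : ∀ x, 0 ≤ g x) {a C : ℝ}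
    (ha : a ≤ 0) (hC : 0 ≤ C)
    (h : ∀ ε : ℝ, 0 < ε → ε ≤ 1 → ∫ x in s, g x * regWeight ε (a / 2) x ≤ C) :
    ∫ x in s, g x * ‖x‖ ^ a ≤ C := by
  by_cases hi : IntegrableOn (fun x => g x * ‖x‖ ^ a) s
  swap
  · rwa [integral_undef hi]
  have hne : ∀ᵐ x ∂(volume.restrict s), x ≠ (0 : EuclideanSpace ℝ (Fin n)) :=
    ae_restrict_of_ae (Measure.ae_ne volume 0)
  have hpos : ∀ k : ℕ, (0 : ℝ) < 1 / ((k : ℝ) + 1) := fun k => Nat.one_div_pos_of_nat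
  have hlim : Tendsto (fun k : ℕ => ∫ x in s, g x * regWeight (1 / ((k : ℝ) + 1)) (a / 2) x)
      atTop (𝓝 (∫ x in s, g x * ‖x‖ ^ a)) := by
    refine tendsto_integral_of_dominated_convergence (fun x => g x * ‖x‖ ^ a) (fun k => ?_) hi
      (fun k => ?_) ?_
    · exact (hg.mul (contDiff_regWeight (hpos k) _).continuous).aestronglyMeasurable
    · filter_upwards [hne] with x hx
      rw [Real.norm_of_nonneg (mul_nonneg (hg0 x) (regWeight_pos (hpos k) _ x).le)]
      exact mul_le_mul_of_nonneg_left (regWeight_le_rpow_norm ha (hpos k) hx) (hg0 x)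
    · filter_upwards [hne] with x hx
      exact ((tendsto_regWeight hx).comp tendsto_one_div_add_atTop_nhds_zero_nat).const_mul _
  exact le_of_tendsto' hlim fun k => h _ (hpos k) <| by
    rw [div_le_one (by positivity)]
    linarith [Nat.cast_nonneg (α := ℝ) k]

end WeightedEstimate

/-- Weighted (Morrey-type) interior estimate (Proposition 3.3): for
`3 ≤ n ≤ 6` and stable solutions of `-Δu = f(u)` in `B₁` with `f ≥ 0` and
`f''f ≥ (1+θ)f'² - K` on `[0,1)`,
`∫_{B_{3/16}} (f(u)² + |x|²|∇(f∘u)|²) |x|^{2-n} ≤ C (∫_{B_{3/4}} u)²`, `C = C(n, θ, K)`. -/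
theorem stmt9 (n : ℕ) (hn3 : 3 ≤ n) (hn6 : n ≤ 6) (θ K : ℝ) (hθ : 0 < θ) (hK : 0 ≤ K) :
    ∃ C : ℝ, 0 < C ∧
      ∀ (f f' f'' : ℝ → ℝ) (u : EuclideanSpace ℝ (Fin n) → ℝ),
        C2On01 f f' f'' →
        (∀ t ∈ Ico (0:ℝ) 1, 0 ≤ f t) →
        (∀ t ∈ Ico (0:ℝ) 1, (1 + θ) * f' t ^ 2 - K ≤ f'' t * f t) →
        ContDiffOn ℝ 2 u (ball (0:EuclideanSpace ℝ (Fin n)) 1) →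
        (∀ x ∈ ball (0:EuclideanSpace ℝ (Fin n)) 1, 0 ≤ u x ∧ u x < 1) →
        (∀ x ∈ ball (0:EuclideanSpace ℝ (Fin n)) 1, -lap u x = f (u x)) →
        StableSol f' u (ball 0 1) →
        (∫ x in ball (0:EuclideanSpace ℝ (Fin n)) (3/16),
            (f (u x) ^ 2 + ‖x‖ ^ 2 * ‖gradient (fun y => f (u y)) x‖ ^ 2) *
              ‖x‖ ^ ((2:ℝ) - n)) ≤
          C * (∫ x in ball (0:EuclideanSpace ℝ (Fin n)) (3/4), u x) ^ 2 := by
  obtain ⟨C, hC, hest⟩ := exists_setIntegral_regWeight_le n hn3 hn6 θ K hθ hK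
  refine ⟨C, hC, fun f f' f'' u hf hf0 hff hu h01 heq hst => ?_⟩
  obtain ⟨U, W, h, hUW⟩ := exists_stablePair hf hf0 hff hu h01 heq hst
  have : Nonempty (Fin n) := ⟨⟨0, by omega⟩⟩
  have hu : ∫ x in ball (0 : EuclideanSpace ℝ (Fin n)) (3 / 4), u x =
      ∫ x in ball (0 : EuclideanSpace ℝ (Fin n)) (3 / 4), U x :=
    setIntegral_congr_fun measurableSet_ball fun x hx => ((hUW x hx).1).symm
  have hF : ∫ x in ball (0 : EuclideanSpace ℝ (Fin n)) (3 / 16),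
      (f (u x) ^ 2 + ‖x‖ ^ 2 * ‖gradient (fun y => f (u y)) x‖ ^ 2) * ‖x‖ ^ ((2 : ℝ) - n) =
      ∫ x in ball (0 : EuclideanSpace ℝ (Fin n)) (3 / 16),
        (W x ^ 2 + ‖x‖ ^ 2 * ‖gradient W x‖ ^ 2) * ‖x‖ ^ ((2 : ℝ) - n) := by
    refine setIntegral_congr_fun measurableSet_ball fun x hx => ?_
    have hx' : x ∈ ball (0 : EuclideanSpace ℝ (Fin n)) (3 / 4) :=
      ball_subset_ball (by norm_num) hx
    have hev : (fun y => f (u y)) =ᶠ[𝓝 x] W := by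
      filter_upwards [isOpen_ball.mem_nhds hx'] with y hy
      exact ((hUW y hy).2).symm
    rw [hev.gradient_eq, (hUW x hx').2]
  have cW := h.contDiff_right.continuous
  have cgW := continuous_gradient h.contDiff_one_right
  have hn3' : (3 : ℝ) ≤ n := by exact_mod_cast hn3
  rw [hF, hu]
  exact setIntegral_mul_rpow_norm_le (by fun_prop) (fun x => by positivity) (by linarith)
    (by positivity) (hest U W h)
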